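/- arXiv:2501.16092 — 6 statements merged into one kernel-verified Lean document; each statement's English description precedes it below -/
import Mathlib

section
/- Let μ̄ be a Borel probability measure on ℝ^d, t₀ > 0, and let (P_t)_{t∈[0,t₀]} be a family of Markov kernels on ℝ^d such that P_0 is the identity kernel, P_s ∘ P_t = P_{s+t} whenever s, t ≥ 0 with s + t ≤ t₀, and μ̄ P_t = μ̄ for every t ∈ [0, t₀]. Let h : [0, t₀] → [0, ∞) be measurable and assume the pointwise semigroup log-Sobolev inequality: for every t ∈ [0, t₀], every x ∈ ℝ^d and every f ∈ F, P_t(f log f)(x) − (P_t f)(x) log (P_t f)(x) ≤ 4 h(t) · P_t(|∇f|²/(4f))(x). Let 1 < p < q < ∞ and C₀ ≥ 1 be such that (∫ |P_{t₀} f|^q dμ̄)^{1/q} ≤ C₀ (∫ |f|^p dμ̄)^{1/p} for every bounded measurable f : ℝ^d → ℝ. Then for every f ∈ F with ∫ f dμ̄ = 1 one has ∫ f log f dμ̄ ≤ (4p(q−1)/(q−p)) · h(t₀) · ∫ |∇f|²/(4f) dμ̄ + (pq/(q−p)) · log C₀. -/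
open MeasureTheory Real

/-- `|∇ f^{1/2}|² = |∇f|² / (4f)` for a positive differentiable function `f`. -/
noncomputable def gradSq {d : ℕ} (f : EuclideanSpace ℝ (Fin d) → ℝ)
    (x : EuclideanSpace ℝ (Fin d)) : ℝ :=
  ‖gradient f x‖ ^ 2 / (4 * f x)

/-- The class `F` of smooth, bounded functions with bounded gradient and positive infimum. -/
def memF {d : ℕ} (f : EuclideanSpace ℝ (Fin d) → ℝ) : Prop :=
  ContDiff ℝ (⊤ : ℕ∞) f ∧ (∃ C, ∀ x, |f x| ≤ C) ∧ (∃ C, ∀ x, ‖gradient f x‖ ≤ C) ∧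
    ∃ c > 0, ∀ x, c ≤ f x

open ProbabilityTheory

section BoundedFunctions

variable {X : Type*} [MeasurableSpace X] {ν : Measure X} {f g : X → ℝ} {a b : ℝ}

theorem integrable_of_forall_mem_Icc [IsFiniteMeasure ν] (hf : Measurable f)
    (hab : ∀ x, f x ∈ Set.Icc a b) : Integrable f ν :=
  Integrable.of_bound hf.aestronglyMeasurable (max |a| |b|)
    (ae_of_all _ fun x => abs_le_max_abs_abs (hab x).1 (hab x).2)

theorem integrable_comp_of_forall_mem_Icc [IsFiniteMeasure ν] {φ : ℝ → ℝ} (hφ : Measurable φ)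
    (hφc : ContinuousOn φ (Set.Icc a b)) (hf : Measurable f) (hab : ∀ x, f x ∈ Set.Icc a b) :
    Integrable (fun x => φ (f x)) ν := by
  obtain ⟨C, hC⟩ := isCompact_Icc.exists_bound_of_continuousOn hφc
  exact Integrable.of_bound (hφ.comp hf).aestronglyMeasurable C
    (ae_of_all _ fun x => hC _ (hab x))

theorem integrable_mul_log [IsFiniteMeasure ν] (hf : Measurable f)
    (hab : ∀ x, f x ∈ Set.Icc a b) : Integrable (fun x => f x * log (f x)) ν :=
  integrable_comp_of_forall_mem_Icc (φ := fun y => y * log y)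
    (measurable_id.mul measurable_log) continuous_mul_log.continuousOn hf hab

theorem integral_mem_Icc [IsProbabilityMeasure ν] (hf : Measurable f)
    (hab : ∀ x, f x ∈ Set.Icc a b) : ∫ x, f x ∂ν ∈ Set.Icc a b := by
  have hi := integrable_of_forall_mem_Icc (ν := ν) hf hab
  constructor
  · simpa using integral_mono (integrable_const a) hi fun x => (hab x).1
  · simpa using integral_mono hi (integrable_const b) fun x => (hab x).2

theorem rpow_mem_Icc {y s : ℝ} (ha : 0 < a) (hs : 0 ≤ s) (hy : y ∈ Set.Icc a b) :
    y ^ s ∈ Set.Icc (a ^ s) (b ^ s) :=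
  ⟨rpow_le_rpow ha.le hy.1 hs, rpow_le_rpow (ha.le.trans hy.1) hy.2 hs⟩

/-- Jensen's inequality for the logarithm under the probability measure proportional to `f ν`. -/
theorem integral_mul_log_integral_sub_le [IsProbabilityMeasure ν] (ha : 0 < a)
    (hf : Measurable f) (hab : ∀ x, f x ∈ Set.Icc a b) {s : ℝ} (hs : 0 ≤ s) :
    (∫ x, f x ∂ν) * log (∫ x, f x ∂ν) - (1 - s) * ∫ x, f x * log (f x) ∂ν ≤
      (∫ x, f x ∂ν) * log (∫ x, f x ^ s ∂ν) := by
  have hfs : Measurable fun x => f x ^ s := hf.pow_const s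
  have habs : ∀ x, f x ^ s ∈ Set.Icc (a ^ s) (b ^ s) := fun x => rpow_mem_Icc ha hs (hab x)
  have hF : 0 < ∫ x, f x ∂ν := ha.trans_le (integral_mem_Icc hf hab).1
  have hG : 0 < ∫ x, f x ^ s ∂ν := (rpow_pos_of_pos ha s).trans_le (integral_mem_Icc hfs habs).1
  set F := ∫ x, f x ∂ν with hFdef
  set G := ∫ x, f x ^ s ∂ν with hGdef
  have hi := integrable_of_forall_mem_Icc (ν := ν) hf hab
  have his := integrable_of_forall_mem_Icc (ν := ν) hfs habs
  have hil := integrable_mul_log (ν := ν) hf hab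
  have key : ∀ x, (s - 1) * (f x * log (f x)) ≤
      (log G - log F - 1) * f x + F / G * f x ^ s := by
    intro x
    have hx : 0 < f x := ha.trans_le (hab x).1
    have hxs : 0 < f x ^ s := rpow_pos_of_pos hx s
    have h1 := log_le_sub_one_of_pos (x := f x ^ s / f x * (F / G)) (by positivity)
    rw [log_mul (by positivity) (by positivity), log_div hxs.ne' hx.ne', log_div hF.ne' hG.ne',
      log_rpow hx] at h1
    have h2 := mul_le_mul_of_nonneg_left h1 hx.le
    have h3 : f x * (f x ^ s / f x * (F / G) - 1) = F / G * f x ^ s - f x := by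
      field_simp
    rw [h3] at h2
    linarith
  have := integral_mono (hil.const_mul (s - 1))
    ((hi.const_mul (log G - log F - 1)).add (his.const_mul (F / G))) key
  simp only [Pi.add_apply] at this
  rw [integral_add (hi.const_mul _) (his.const_mul _), integral_const_mul, integral_const_mul,
    integral_const_mul, ← hFdef, ← hGdef, div_mul_cancel₀ _ hG.ne'] at this
  linarith

/-- The Gibbs variational inequality tested against `q * log g`. -/
theorem mul_integral_mul_log_le [IsProbabilityMeasure ν] {a' b' : ℝ} (ha : 0 < a) (ha' : 0 < a')
    (hf : Measurable f) (hab : ∀ x, f x ∈ Set.Icc a b)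
    (hg : Measurable g) (hab' : ∀ x, g x ∈ Set.Icc a' b') (hf1 : ∫ x, f x ∂ν = 1)
    {q K : ℝ} (hq : 0 ≤ q) (hK : 0 < K) (hgK : ∫ x, g x ^ q ∂ν ≤ K) :
    q * ∫ x, f x * log (g x) ∂ν ≤ ∫ x, f x * log (f x) ∂ν + log K := by
  have hi := integrable_of_forall_mem_Icc (ν := ν) hf hab
  have hil := integrable_mul_log (ν := ν) hf hab
  have hiq : Integrable (fun x => g x ^ q) ν :=
    integrable_of_forall_mem_Icc (hg.pow_const q) fun x => rpow_mem_Icc ha' hq (hab' x)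
  have hlog : ∀ x, ‖log (g x)‖ ≤ max |log a'| |log b'| := fun x =>
    abs_le_max_abs_abs (log_le_log ha' (hab' x).1)
      (log_le_log (ha'.trans_le (hab' x).1) (hab' x).2)
  have hig : Integrable (fun x => f x * log (g x)) ν :=
    hi.mul_bdd hg.log.aestronglyMeasurable (ae_of_all _ hlog)
  have hsum : Integrable (fun x => (log K - 1) * f x + K⁻¹ * g x ^ q) ν :=
    (hi.const_mul (log K - 1)).add (hiq.const_mul K⁻¹)
  have key : ∀ x, q * (f x * log (g x)) ≤
      f x * log (f x) + ((log K - 1) * f x + K⁻¹ * g x ^ q) := by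
    intro x
    have hx : 0 < f x := ha.trans_le (hab x).1
    have hgx : 0 < g x := ha'.trans_le (hab' x).1
    have hxs : 0 < g x ^ q := rpow_pos_of_pos hgx q
    have h1 := log_le_sub_one_of_pos (x := g x ^ q / (f x * K)) (by positivity)
    rw [log_div hxs.ne' (by positivity), log_mul hx.ne' hK.ne', log_rpow hgx] at h1
    have h2 := mul_le_mul_of_nonneg_left h1 hx.le
    have h3 : f x * (g x ^ q / (f x * K) - 1) = K⁻¹ * g x ^ q - f x := by
      field_simp
    rw [h3] at h2
    linarith
  have := integral_mono (hig.const_mul q) (hil.add hsum) key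
  simp only [Pi.add_apply] at this
  rw [integral_add hil hsum, integral_add (hi.const_mul _) (hiq.const_mul _), integral_const_mul, integral_const_mul,
    integral_const_mul, hf1] at this
  have hle : K⁻¹ * ∫ x, g x ^ q ∂ν ≤ 1 := by
    rw [inv_mul_le_iff₀ hK]; simpa using hgK
  linarith

end BoundedFunctions

section InvariantKernel

variable {X : Type*} [MeasurableSpace X] {μ : Measure X} {κ : Kernel X X} {f : X → ℝ} {a b : ℝ}

theorem integral_integral_of_invariant (hinv : μ.bind κ = μ) (hf : Integrable f μ) :
    ∫ x, ∫ y, f y ∂(κ x) ∂μ = ∫ x, f x ∂μ := by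
  rw [← hinv] at hf
  conv_rhs => rw [← hinv]
  rw [Measure.comp_eq_comp_const_apply] at hf ⊢
  rw [Kernel.integral_comp hf]
  simp

theorem integrable_integral_of_invariant (hinv : μ.bind κ = μ) (hf : Integrable f μ) :
    Integrable (fun x => ∫ y, f y ∂(κ x)) μ := by
  rw [← hinv, Measure.comp_eq_comp_const_apply] at hf
  simpa using hf.integral_comp

/-- The infinitesimal form at `L¹` of the interpolation between the contraction on `L¹` and a
bound from `Lᵖ` to `L^q` of an invariant Markov kernel. -/
theorem entropy_kernel_le_of_hyperbounded [IsProbabilityMeasure μ] [IsMarkovKernel κ]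
    (hinv : μ.bind κ = μ) (ha : 0 < a)
    (hf : Measurable f) (hab : ∀ x, f x ∈ Set.Icc a b) (hf1 : ∫ x, f x ∂μ = 1)
    {p q C : ℝ} (hp : 0 < p) (hq : 0 < q) (hC : 0 < C)
    (hyper : (∫ x, |∫ y, f y ^ (1 / p) ∂(κ x)| ^ q ∂μ) ^ (1 / q) ≤ C) :
    (1 - 1 / q) * ∫ x, (∫ y, f y ∂(κ x)) * log (∫ y, f y ∂(κ x)) ∂μ ≤
      (1 - 1 / p) * ∫ x, f x * log (f x) ∂μ + log C := by
  have hp' : 0 ≤ 1 / p := by positivity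
  have hfs : Measurable fun x => f x ^ (1 / p) := hf.pow_const _
  have habs : ∀ x, f x ^ (1 / p) ∈ Set.Icc (a ^ (1 / p)) (b ^ (1 / p)) :=
    fun x => rpow_mem_Icc ha hp' (hab x)
  have ha' : 0 < a ^ (1 / p) := rpow_pos_of_pos ha _
  have hF : Measurable fun x => ∫ y, f y ∂(κ x) :=
    (hf.stronglyMeasurable.integral_kernel (κ := κ)).measurable
  have hG : Measurable fun x => ∫ y, f y ^ (1 / p) ∂(κ x) :=
    (hfs.stronglyMeasurable.integral_kernel (κ := κ)).measurable
  have hFab : ∀ x, ∫ y, f y ∂(κ x) ∈ Set.Icc a b := fun x => integral_mem_Icc hf hab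
  have hGab : ∀ x, ∫ y, f y ^ (1 / p) ∂(κ x) ∈ Set.Icc (a ^ (1 / p)) (b ^ (1 / p)) :=
    fun x => integral_mem_Icc hfs habs
  have hF1 : ∫ x, ∫ y, f y ∂(κ x) ∂μ = 1 := by
    rw [integral_integral_of_invariant hinv (integrable_of_forall_mem_Icc hf hab), hf1]
  have hK : ∫ x, (∫ y, f y ^ (1 / p) ∂(κ x)) ^ q ∂μ ≤ C ^ q := by
    have hcongr : ∀ x, |∫ y, f y ^ (1 / p) ∂(κ x)| = ∫ y, f y ^ (1 / p) ∂(κ x) :=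
      fun x => abs_of_pos (ha'.trans_le (hGab x).1)
    simp only [hcongr] at hyper
    have h0 : 0 ≤ ∫ x, (∫ y, f y ^ (1 / p) ∂(κ x)) ^ q ∂μ :=
      integral_nonneg fun x => rpow_nonneg (ha'.le.trans (hGab x).1) q
    have := rpow_le_rpow (rpow_nonneg h0 _) hyper hq.le
    rwa [← rpow_mul h0, one_div_mul_cancel hq.ne', rpow_one] at this
  have gibbs := mul_integral_mul_log_le ha ha' hF hFab hG hGab hF1 hq.le
    (rpow_pos_of_pos hC q) hK
  rw [log_rpow hC] at gibbs
  have hil := integrable_mul_log (ν := μ) hf hab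
  have hilF := integrable_mul_log (ν := μ) hF hFab
  have hilP := integrable_integral_of_invariant hinv hil
  have hlog : ∀ x, ‖log (∫ y, f y ^ (1 / p) ∂(κ x))‖ ≤
      max |log (a ^ (1 / p))| |log (b ^ (1 / p))| := fun x =>
    abs_le_max_abs_abs (log_le_log ha' (hGab x).1)
      (log_le_log (ha'.trans_le (hGab x).1) (hGab x).2)
  have hiFG : Integrable
      (fun x => (∫ y, f y ∂(κ x)) * log (∫ y, f y ^ (1 / p) ∂(κ x))) μ :=
    (integrable_of_forall_mem_Icc hF hFab).mul_bdd hG.log.aestronglyMeasurable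
      (ae_of_all _ hlog)
  have jensen := integral_mono (hilF.sub (hilP.const_mul (1 - 1 / p))) hiFG
    fun x => integral_mul_log_integral_sub_le (ν := κ x) ha hf hab hp'
  simp only [Pi.sub_apply] at jensen
  rw [integral_sub hilF (hilP.const_mul _), integral_const_mul,
    integral_integral_of_invariant hinv hil] at jensen
  have hdiv := mul_le_mul_of_nonneg_left gibbs (one_div_nonneg.mpr hq.le)
  rw [← mul_assoc, one_div_mul_cancel hq.ne', mul_add, ← mul_assoc,
    one_div_mul_cancel hq.ne'] at hdiv
  linarith

end InvariantKernel

theorem measurable_gradient {E : Type*} [NormedAddCommGroup E] [InnerProductSpace ℝ E]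
    [CompleteSpace E] [MeasurableSpace E] [BorelSpace E] (f : E → ℝ) :
    Measurable (gradient f) :=
  (InnerProductSpace.toDual ℝ E).symm.continuous.measurable.comp (measurable_fderiv ℝ f)

theorem memF.integrable_gradSq {d : ℕ} {f : EuclideanSpace ℝ (Fin d) → ℝ} (hf : memF f)
    (ν : Measure (EuclideanSpace ℝ (Fin d))) [IsFiniteMeasure ν] : Integrable (gradSq f) ν := by
  obtain ⟨hsm, -, ⟨C, hC⟩, c, hc, hcf⟩ := hf
  refine integrable_of_forall_mem_Icc (a := 0) (b := C ^ 2 / (4 * c)) ?_ fun x => ?_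
  · exact ((measurable_gradient f).norm.pow_const 2).div
      (hsm.continuous.measurable.const_mul 4)
  · have hx : 0 < f x := hc.trans_le (hcf x)
    have := hcf x
    have := hC x
    exact ⟨by unfold gradSq; positivity, by unfold gradSq; gcongr⟩

theorem stmt_0 {d : ℕ}
    (μ : Measure (EuclideanSpace ℝ (Fin d))) (hμ : IsProbabilityMeasure μ)
    (t₀ : ℝ) (ht₀ : 0 < t₀)
    (P : ℝ → EuclideanSpace ℝ (Fin d) → Measure (EuclideanSpace ℝ (Fin d)))
    (hPmeas : ∀ t ∈ Set.Icc (0:ℝ) t₀, Measurable (P t))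
    (hPprob : ∀ t ∈ Set.Icc (0:ℝ) t₀, ∀ x, IsProbabilityMeasure (P t x))
    (hP0 : ∀ x, P 0 x = Measure.dirac x)
    (hPsemi : ∀ s t : ℝ, 0 ≤ s → 0 ≤ t → s + t ≤ t₀ → ∀ x,
      (P s x).bind (P t) = P (s + t) x)
    (hPinv : ∀ t ∈ Set.Icc (0:ℝ) t₀, μ.bind (P t) = μ)
    (h : ℝ → ℝ) (hh : Measurable h) (hhnn : ∀ t ∈ Set.Icc (0:ℝ) t₀, 0 ≤ h t)
    (hLSI : ∀ t ∈ Set.Icc (0:ℝ) t₀, ∀ x, ∀ f : EuclideanSpace ℝ (Fin d) → ℝ, memF f →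
      (∫ y, f y * log (f y) ∂(P t x)) -
          (∫ y, f y ∂(P t x)) * log (∫ y, f y ∂(P t x)) ≤
        4 * h t * ∫ y, gradSq f y ∂(P t x))
    (p q C₀ : ℝ) (hp : 1 < p) (hpq : p < q) (hC₀ : 1 ≤ C₀)
    (hHyper : ∀ f : EuclideanSpace ℝ (Fin d) → ℝ, Measurable f → (∃ C, ∀ x, |f x| ≤ C) →
      (∫ x, |∫ y, f y ∂(P t₀ x)| ^ q ∂μ) ^ (1 / q) ≤
        C₀ * (∫ x, |f x| ^ p ∂μ) ^ (1 / p))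
    (f : EuclideanSpace ℝ (Fin d) → ℝ) (hf : memF f) (hfint : ∫ x, f x ∂μ = 1) :
    ∫ x, f x * log (f x) ∂μ ≤
      4 * p * (q - 1) / (q - p) * h t₀ * ∫ x, gradSq f x ∂μ +
        p * q / (q - p) * log C₀ := by
  obtain ⟨M, hM⟩ := hf.2.1
  obtain ⟨c, hc, hcf⟩ := hf.2.2.2
  have hfm : Measurable f := hf.1.continuous.measurable
  have hab : ∀ x, f x ∈ Set.Icc c M := fun x => ⟨hcf x, (le_abs_self _).trans (hM x)⟩
  have hmem : t₀ ∈ Set.Icc (0:ℝ) t₀ := ⟨ht₀.le, le_rfl⟩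
  let κ : Kernel (EuclideanSpace ℝ (Fin d)) (EuclideanSpace ℝ (Fin d)) :=
    ⟨P t₀, hPmeas t₀ hmem⟩
  have hκ : IsMarkovKernel κ := ⟨hPprob t₀ hmem⟩
  have hinv : μ.bind κ = μ := hPinv t₀ hmem
  have hp0 : 0 < p := zero_lt_one.trans hp
  have hq0 : 0 < q := hp0.trans hpq
  have hfp : ∀ x, f x ^ (1 / p) ∈ Set.Icc (c ^ (1 / p)) (M ^ (1 / p)) :=
    fun x => rpow_mem_Icc hc (by positivity) (hab x)
  have hyper := hHyper (fun x => f x ^ (1 / p)) (hfm.pow_const _)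
    ⟨_, fun x => abs_le_max_abs_abs (hfp x).1 (hfp x).2⟩
  have hnorm : ∫ x, |f x ^ (1 / p)| ^ p ∂μ = 1 := by
    refine Eq.trans ?_ hfint
    refine integral_congr_ae (ae_of_all _ fun x => ?_)
    have hx : 0 < f x := hc.trans_le (hcf x)
    simp only
    rw [abs_of_pos (rpow_pos_of_pos hx _), ← rpow_mul hx.le, one_div_mul_cancel hp0.ne', rpow_one]
  rw [hnorm, one_rpow, mul_one] at hyper
  have hent := entropy_kernel_le_of_hyperbounded (κ := κ) hinv hc hfm hab hfint hp0 hq0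
    (zero_lt_one.trans_le hC₀) hyper
  have hF : Measurable fun x => ∫ y, f y ∂(κ x) :=
    (hfm.stronglyMeasurable.integral_kernel (κ := κ)).measurable
  have hil := integrable_mul_log (ν := μ) hfm hab
  have hilF := integrable_mul_log (ν := μ) hF fun x => integral_mem_Icc hfm hab
  have hilP := integrable_integral_of_invariant hinv hil
  have hig := hf.integrable_gradSq μ
  have hlsi := integral_mono (hilP.sub hilF)
    ((integrable_integral_of_invariant hinv hig).const_mul (4 * h t₀))
    fun x => hLSI t₀ hmem x f hf
  simp only [Pi.sub_apply] at hlsi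
  rw [integral_sub hilP hilF, integral_const_mul, integral_integral_of_invariant hinv hil,
    integral_integral_of_invariant hinv hig] at hlsi
  have hq1 : 0 ≤ 1 - 1 / q := by
    rw [sub_nonneg, div_le_one hq0]; linarith
  have hcomb := mul_le_mul_of_nonneg_left hlsi hq1
  have hqp : 0 < q - p := sub_pos.mpr hpq
  have hfin : (1 / p - 1 / q) * ∫ x, f x * log (f x) ∂μ ≤
      (1 - 1 / q) * (4 * h t₀ * ∫ x, gradSq f x ∂μ) + log C₀ := by
    linarith
  have hscale := mul_le_mul_of_nonneg_left hfin
    (show 0 ≤ p * q / (q - p) by positivity)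
  calc ∫ x, f x * log (f x) ∂μ
      = p * q / (q - p) * ((1 / p - 1 / q) * ∫ x, f x * log (f x) ∂μ) := by field_simp
    _ ≤ _ := hscale
    _ = _ := by field_simp
end

section
/- Let Θ be a nonempty index set and let (μ_θ)_{θ∈Θ} be Borel probability measures on ℝ^d, each absolutely continuous with respect to Lebesgue measure with density ρ_θ. Assume: (a) the family (μ_θ)_{θ∈Θ} is tight, i.e. for every ε > 0 there exists R > 0 with μ_θ(B_R) ≥ 1 − ε for all θ; (b) for every R > 0 there exist constants 0 < C₁(R) ≤ C₂(R) with C₁(R) ≤ ρ_θ(x) ≤ C₂(R) for (Lebesgue-)a.e. x ∈ B_R and all θ ∈ Θ; (c) for every R > 0 there exists β(R) > 0 such that the Poincaré inequality on B_R for Lebesgue measure holds: ∫_{B_R} f² dx ≤ |B_R|^{-1} (∫_{B_R} f dx)² + β(R) ∫_{B_R} |∇f|² dx for all f ∈ C_c^∞(ℝ^d). Then there exists a nonincreasing function α : (0, ∞) → [0, ∞) such that for every r > 0, every θ ∈ Θ and every f ∈ C_c^∞(ℝ^d) with ∫ f dμ_θ = 0, one has ∫ f² dμ_θ ≤ α(r)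 ∫ |∇f|² dμ_θ + r ‖f‖_∞². -/
open MeasureTheory

/-- Expansion of the integral of the squared deviation from a constant. -/
theorem setIntegral_sub_const_sq {X : Type*} [MeasurableSpace X] {ν : Measure X}
    {B : Set X} (hfin : ν B ≠ ⊤) {f : X → ℝ} (hf : IntegrableOn f B ν)
    (hf2 : IntegrableOn (fun x => f x ^ 2) B ν) (c : ℝ) :
    ∫ x in B, (f x - c) ^ 2 ∂ν
      = ∫ x in B, f x ^ 2 ∂ν - 2 * c * ∫ x in B, f x ∂ν + c ^ 2 * ν.real B := by
  have hexp : ∀ x, (f x - c) ^ 2 = f x ^ 2 - 2 * c * f x + c ^ 2 := fun x => by ring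
  have hconst : IntegrableOn (fun _ => c ^ 2) B ν := integrableOn_const hfin
  have hlin : IntegrableOn (fun x => 2 * c * f x) B ν := Integrable.const_mul hf (2 * c)
  have hdiff : IntegrableOn (fun x => f x ^ 2 - 2 * c * f x) B ν := Integrable.sub hf2 hlin
  simp_rw [hexp]
  rw [integral_add hdiff hconst, integral_sub hf2 hlin, integral_const_mul,
    setIntegral_const, smul_eq_mul, mul_comm (c ^ 2)]

/-- Splitting the second moment of a centred bounded function along a set of almost full
measure. -/
theorem integral_sq_le_setIntegral_sub_sq_add {X : Type*} [MeasurableSpace X] (μ : Measure X)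
    [IsProbabilityMeasure μ] {B : Set X} (hB : MeasurableSet B) {f : X → ℝ} {M ε : ℝ}
    (hf : Integrable f μ) (hf2 : Integrable (fun x => f x ^ 2) μ) (hM : ∀ x, |f x| ≤ M)
    (hε : ε ≤ 1 / 2) (hμB : 1 - ε ≤ μ.real B) (hmean : ∫ x, f x ∂μ = 0) (c : ℝ) :
    ∫ x, f x ^ 2 ∂μ ≤ ∫ x in B, (f x - c) ^ 2 ∂μ + 2 * ε * M ^ 2 := by
  have hsplit := integral_add_compl hB hf2
  have hsplit1 := integral_add_compl hB hf
  have hcompl : μ.real B + μ.real Bᶜ = 1 := by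
    simpa using measureReal_add_measureReal_compl (μ := μ) hB
  have hε0 : 0 ≤ ε := by
    have := measureReal_le_one (μ := μ) (s := B)
    linarith
  have hout : ∫ x in Bᶜ, f x ^ 2 ∂μ ≤ ε * M ^ 2 := by
    have h1 : ∫ x in Bᶜ, f x ^ 2 ∂μ ≤ ∫ _ in Bᶜ, M ^ 2 ∂μ :=
      integral_mono hf2.integrableOn (integrable_const _) fun x => sq_le_sq' (abs_le.1 (hM x)).1
        (abs_le.1 (hM x)).2
    rw [setIntegral_const, smul_eq_mul] at h1
    exact h1.trans (mul_le_mul_of_nonneg_right (by linarith) (sq_nonneg M))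
  have hout1 : |∫ x in Bᶜ, f x ∂μ| ≤ M * μ.real Bᶜ := by
    rw [← Real.norm_eq_abs]
    exact norm_setIntegral_le_of_norm_le_const (measure_lt_top μ _) fun x _ => hM x
  have hI : (∫ x in B, f x ∂μ) ^ 2 ≤ ε ^ 2 * M ^ 2 := by
    have h2 : ∫ x in B, f x ∂μ = -∫ x in Bᶜ, f x ∂μ := by linarith
    rw [h2, neg_sq, ← sq_abs, ← mul_pow]
    rcases isEmpty_or_nonempty X with hX | ⟨⟨x₀⟩⟩
    · have : B = ∅ := Set.eq_empty_of_isEmpty B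
      simp [this] at hμB
      linarith
    · have hM0 : 0 ≤ M := (abs_nonneg _).trans (hM x₀)
      refine pow_le_pow_left₀ (abs_nonneg _) (hout1.trans ?_) 2
      rw [mul_comm]
      exact mul_le_mul_of_nonneg_right (by linarith) hM0
  have hexp := setIntegral_sub_const_sq (measure_ne_top μ B) hf.integrableOn hf2.integrableOn c
  set I := ∫ x in B, f x ∂μ
  have hsq : 2 * c * I ≤ c ^ 2 * μ.real B + ε * M ^ 2 := by
    have h4 : c ^ 2 * (1 / 2) ≤ c ^ 2 * (1 - ε) :=
      mul_le_mul_of_nonneg_left (by linarith) (sq_nonneg c)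
    have h5 : c ^ 2 * (1 - ε) ≤ c ^ 2 * μ.real B :=
      mul_le_mul_of_nonneg_left hμB (sq_nonneg c)
    have h6 : 2 * I ^ 2 ≤ ε * M ^ 2 := by
      have : ε * (ε * M ^ 2) ≤ 1 / 2 * (ε * M ^ 2) :=
        mul_le_mul_of_nonneg_right hε (by positivity)
      nlinarith
    nlinarith [sq_nonneg (c - 2 * I)]
  linarith

/-- Density bounds compare the integrals of a nonnegative function with respect to a measure with
density and to the reference measure. -/
theorem setIntegral_withDensity_bounds {X : Type*} [MeasurableSpace X] (ν : Measure X)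
    {B : Set X} (hB : MeasurableSet B) {ρ : X → ℝ} {C₁ C₂ : ℝ} (hC₁ : 0 ≤ C₁) (hC : C₁ ≤ C₂)
    (hρ : ∀ᵐ x ∂(ν.restrict B), C₁ ≤ ρ x ∧ ρ x ≤ C₂) {g : X → ℝ} (hg0 : ∀ x, 0 ≤ g x)
    (hg : IntegrableOn g B ν) :
    C₁ * ∫ x in B, g x ∂ν ≤ ∫ x in B, g x ∂(ν.withDensity fun x => ENNReal.ofReal (ρ x)) ∧
    ∫ x in B, g x ∂(ν.withDensity fun x => ENNReal.ofReal (ρ x)) ≤ C₂ * ∫ x in B, g x ∂ν := by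
  have hC₂ : 0 ≤ C₂ := hC₁.trans hC
  rw [restrict_withDensity hB]
  have hlow : ENNReal.ofReal C₁ • ν.restrict B ≤
      (ν.restrict B).withDensity fun x => ENNReal.ofReal (ρ x) := by
    rw [← withDensity_const]
    exact withDensity_mono (hρ.mono fun x hx => ENNReal.ofReal_le_ofReal hx.1)
  have hup : (ν.restrict B).withDensity (fun x => ENNReal.ofReal (ρ x)) ≤
      ENNReal.ofReal C₂ • ν.restrict B := by
    rw [← withDensity_const]
    exact withDensity_mono (hρ.mono fun x hx => ENNReal.ofReal_le_ofReal hx.2)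
  have hgC : Integrable g (ENNReal.ofReal C₂ • ν.restrict B) :=
    Integrable.smul_measure hg ENNReal.ofReal_ne_top
  constructor
  · have := integral_mono_measure hlow (Filter.Eventually.of_forall hg0) (hgC.mono_measure hup)
    rwa [integral_smul_measure, ENNReal.toReal_ofReal hC₁, smul_eq_mul] at this
  · have := integral_mono_measure hup (Filter.Eventually.of_forall hg0) hgC
    rwa [integral_smul_measure, ENNReal.toReal_ofReal hC₂, smul_eq_mul] at this

/-- The integral of the squared deviation from the mean. -/
theorem setIntegral_sub_average_sq {X : Type*} [MeasurableSpace X] (ν : Measure X)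
    {B : Set X} (hfin : ν B ≠ ⊤) {f : X → ℝ} (hf : IntegrableOn f B ν)
    (hf2 : IntegrableOn (fun x => f x ^ 2) B ν) :
    ∫ x in B, (f x - (ν B).toReal⁻¹ * ∫ y in B, f y ∂ν) ^ 2 ∂ν
      = ∫ x in B, f x ^ 2 ∂ν - (ν B).toReal⁻¹ * (∫ x in B, f x ∂ν) ^ 2 := by
  rw [setIntegral_sub_const_sq hfin hf hf2, measureReal_def]
  by_cases h0 : (ν B).toReal = 0
  · simp [h0]
  · field_simp
    ring

/-- A downward family of nonempty closed sets of nonnegative admissible constants admits an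
antitone selection. -/
theorem exists_antitoneOn_selection {S : ℝ → Set ℝ} (hne : ∀ r > 0, (S r).Nonempty)
    (hcl : ∀ r > 0, IsClosed (S r)) (hpos : ∀ r, ∀ a ∈ S r, 0 ≤ a)
    (hmono : ∀ r > 0, ∀ s, r ≤ s → S r ⊆ S s) :
    ∃ α : ℝ → ℝ, AntitoneOn α (Set.Ioi 0) ∧ ∀ r > 0, α r ∈ S r :=
  ⟨fun r => sInf (S r),
    fun r hr s _ hrs => csInf_le_csInf ⟨0, hpos s⟩ (hne r hr) (hmono r hr s hrs),
    fun r hr => (hcl r hr).csInf_mem (hne r hr) ⟨0, hpos r⟩⟩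

theorem stmt_1 {d : ℕ} {Θ : Type*} [Nonempty Θ]
    (μ : Θ → Measure (EuclideanSpace ℝ (Fin d)))
    (hprob : ∀ θ, IsProbabilityMeasure (μ θ))
    (ρ : Θ → EuclideanSpace ℝ (Fin d) → ℝ)
    (hdens : ∀ θ, μ θ = volume.withDensity fun x => ENNReal.ofReal (ρ θ x))
    (htight : ∀ ε > (0:ℝ), ∃ R > (0:ℝ), ∀ θ,
      1 - ε ≤ ((μ θ) (Metric.closedBall 0 R)).toReal)
    (hbdd : ∀ R > (0:ℝ), ∃ C₁ C₂ : ℝ, 0 < C₁ ∧ C₁ ≤ C₂ ∧ ∀ θ,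
      ∀ᵐ x ∂(volume.restrict (Metric.closedBall (0 : EuclideanSpace ℝ (Fin d)) R)),
        C₁ ≤ ρ θ x ∧ ρ θ x ≤ C₂)
    (hpoin : ∀ R > (0:ℝ), ∃ β > (0:ℝ), ∀ f : EuclideanSpace ℝ (Fin d) → ℝ,
      ContDiff ℝ (⊤ : ℕ∞) f → HasCompactSupport f →
      ∫ x in Metric.closedBall 0 R, f x ^ 2 ≤
        (volume (Metric.closedBall (0 : EuclideanSpace ℝ (Fin d)) R)).toReal⁻¹ *
            (∫ x in Metric.closedBall 0 R, f x) ^ 2 +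
          β * ∫ x in Metric.closedBall 0 R, ‖gradient f x‖ ^ 2) :
    ∃ α : ℝ → ℝ, AntitoneOn α (Set.Ioi 0) ∧ (∀ r ∈ Set.Ioi (0:ℝ), 0 ≤ α r) ∧
      ∀ r > (0:ℝ), ∀ θ, ∀ f : EuclideanSpace ℝ (Fin d) → ℝ,
        ContDiff ℝ (⊤ : ℕ∞) f → HasCompactSupport f → (∫ x, f x ∂(μ θ)) = 0 →
        ∫ x, f x ^ 2 ∂(μ θ) ≤
          α r * ∫ x, ‖gradient f x‖ ^ 2 ∂(μ θ) + r * (⨆ x, |f x|) ^ 2 := by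
  let S : ℝ → Set ℝ := fun r => {a | 0 ≤ a ∧ ∀ θ, ∀ f : EuclideanSpace ℝ (Fin d) → ℝ,
        ContDiff ℝ (⊤ : ℕ∞) f → HasCompactSupport f → (∫ x, f x ∂(μ θ)) = 0 →
        ∫ x, f x ^ 2 ∂(μ θ) ≤
          a * ∫ x, ‖gradient f x‖ ^ 2 ∂(μ θ) + r * (⨆ x, |f x|) ^ 2}
  obtain ⟨α, hα, hαS⟩ : ∃ α : ℝ → ℝ, AntitoneOn α (Set.Ioi 0) ∧ ∀ r > 0, α r ∈ S r := by
    refine exists_antitoneOn_selection ?_ ?_ (fun r a ha => ha.1) ?_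
    · intro r hr
      obtain ⟨ε, hε, hεr, hε2⟩ : ∃ ε > (0 : ℝ), 2 * ε ≤ r ∧ ε ≤ 1 / 2 :=
        ⟨min (r / 2) (1 / 2), by positivity, by linarith [min_le_left (r / 2) (1 / 2)],
          min_le_right _ _⟩
      obtain ⟨R, hR, hRμ⟩ := htight ε hε
      obtain ⟨C₁, C₂, hC₁, hC, hρ⟩ := hbdd R hR
      obtain ⟨β, hβ, hP⟩ := hpoin R hR
      have hC₂ : 0 < C₂ := hC₁.trans_le hC
      refine ⟨C₂ * (β * C₁⁻¹), by positivity, fun θ f hf hfc hmean => ?_⟩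
      have := hprob θ
      set B := Metric.closedBall (0 : EuclideanSpace ℝ (Fin d)) R
      have hBm : MeasurableSet B := measurableSet_closedBall
      have hBc : IsCompact B := isCompact_closedBall 0 R
      have hfcont : Continuous f := hf.continuous
      have hgrad : ∀ x, ‖gradient f x‖ = ‖fderiv ℝ f x‖ := fun x => by simp [gradient]
      have hgcont : Continuous fun x => ‖gradient f x‖ ^ 2 := by
        simp_rw [hgrad]
        exact (hf.continuous_fderiv (by simp)).norm.pow 2
      have hgsupp : HasCompactSupport fun x => ‖gradient f x‖ ^ 2 := by
        simp_rw [hgrad]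
        exact (hfc.fderiv (𝕜 := ℝ)).comp_left (g := fun L => ‖L‖ ^ 2) (by simp)
      have hM : ∀ x, |f x| ≤ ⨆ x, |f x| := by
        obtain ⟨C, hC⟩ := hfc.exists_bound_of_continuous hfcont
        exact le_ciSup ⟨C, Set.forall_mem_range.2 hC⟩
      have hfi : Integrable f (μ θ) := hfcont.integrable_of_hasCompactSupport hfc
      have hf2cont : Continuous fun x => f x ^ 2 := hfcont.pow 2
      have hf2c : HasCompactSupport fun x => f x ^ 2 :=
        hfc.comp_left (g := fun y : ℝ => y ^ 2) (by simp)
      have hf2i : Integrable (fun x => f x ^ 2) (μ θ) :=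
        hf2cont.integrable_of_hasCompactSupport hf2c
      set c := (volume B).toReal⁻¹ * ∫ x in B, f x
      have hkey := integral_sq_le_setIntegral_sub_sq_add (μ θ) hBm hfi hf2i hM
        hε2 (hRμ θ) hmean c
      have hdev := setIntegral_sub_average_sq (volume : Measure (EuclideanSpace ℝ (Fin d)))
        hBc.measure_lt_top.ne (hfcont.continuousOn.integrableOn_compact hBc)
        (hf2cont.continuousOn.integrableOn_compact hBc)
      have hup := (setIntegral_withDensity_bounds volume hBm hC₁.le hC (hρ θ)
        (g := fun x => (f x - c) ^ 2) (fun x => sq_nonneg _)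
        (((hfcont.sub continuous_const).pow 2).continuousOn.integrableOn_compact hBc)).2
      have hlow := (setIntegral_withDensity_bounds volume hBm hC₁.le hC (hρ θ)
        (g := fun x => ‖gradient f x‖ ^ 2) (fun x => sq_nonneg _)
        (hgcont.continuousOn.integrableOn_compact hBc)).1
      rw [← hdens θ] at hup hlow
      have hglob : ∫ x in B, ‖gradient f x‖ ^ 2 ∂(μ θ) ≤ ∫ x, ‖gradient f x‖ ^ 2 ∂(μ θ) :=
        setIntegral_le_integral (hgcont.integrable_of_hasCompactSupport hgsupp)
          (Filter.Eventually.of_forall fun x => sq_nonneg _)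
      have hgB : ∫ x in B, ‖gradient f x‖ ^ 2 ≤ C₁⁻¹ * ∫ x, ‖gradient f x‖ ^ 2 ∂(μ θ) :=
        (le_inv_mul_iff₀ hC₁).2 (hlow.trans hglob)
      have hdev' : ∫ x in B, (f x - c) ^ 2 ≤ β * (C₁⁻¹ * ∫ x, ‖gradient f x‖ ^ 2 ∂(μ θ)) := by
        have h1 := mul_le_mul_of_nonneg_left hgB hβ.le
        have h2 := hP f hf hfc
        linarith
      have h3 := mul_le_mul_of_nonneg_left hdev' hC₂.le
      have h4 : 2 * ε * (⨆ x, |f x|) ^ 2 ≤ r * (⨆ x, |f x|) ^ 2 :=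
        mul_le_mul_of_nonneg_right hεr (sq_nonneg _)
      linarith
    · intro r _
      simp only [S, Set.ofPred_and, Set.ofPred_forall]
      refine isClosed_Ici.inter ?_
      refine isClosed_iInter fun θ => isClosed_iInter fun f => isClosed_iInter fun _ =>
        isClosed_iInter fun _ => isClosed_iInter fun _ => ?_
      exact isClosed_le continuous_const (by fun_prop)
    · intro r _ s hrs a ha
      refine ⟨ha.1, fun θ f hf hfc hmean => (ha.2 θ f hf hfc hmean).trans ?_⟩
      gcongr
  exact ⟨α, hα, fun r hr => (hαS r hr).1, fun r hr => (hαS r hr).2⟩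
end

section
/- Let Θ be a nonempty index set and let (μ_θ)_{θ∈Θ} be Borel probability measures on ℝ^d, each absolutely continuous with respect to Lebesgue measure with density ρ_θ. Assume: (a) the family (μ_θ)_{θ∈Θ} is tight, i.e. for every ε > 0 there exists R > 0 with μ_θ(B_R) ≥ 1 − ε for all θ; (b) for every R > 0 there exist constants 0 < C₁(R) ≤ C₂(R) with C₁(R) ≤ ρ_θ(x) ≤ C₂(R) for (Lebesgue-)a.e. x ∈ B_R and all θ ∈ Θ; (c) for every R > 0 there exists β(R) > 0 such that the Poincaré inequality on B_R for Lebesgue measure holds: ∫_{B_R} f² dx ≤ |B_R|^{-1} (∫_{B_R} f dx)² + β(R) ∫_{B_R} |∇f|² dx for all f ∈ C_c^∞(ℝ^d); (d) the uniform defective log-Sobolev inequality holds: there exist constants D₁, D₂ ≥ 0 such that for every θ ∈ Θ and every f ∈ F, ∫ f log f dμ_θ − (∫ f dμ_θ) log(∫ f dμ_θ) ≤ D₁ ∫ |∇f|²/(4f) dμ_θ + D₂ ∫ f dμ_θ. Then there exists a constant C_LS ≥ 0 such that for every θ ∈ Θ and every f ∈ F, ∫ f log f dμ_θ − (∫ f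 dμ_θ) log(∫ f dμ_θ) ≤ C_LS ∫ |∇f|²/(4f) dμ_θ. -/
open MeasureTheory

/-- The entropy `∫ f log f dμ - (∫ f dμ) log (∫ f dμ)`. -/
noncomputable def entropy {X : Type*} [MeasurableSpace X] (μ : Measure X) (f : X → ℝ) : ℝ :=
  ∫ x, f x * Real.log (f x) ∂μ - (∫ x, f x ∂μ) * Real.log (∫ x, f x ∂μ)

/-- Young's inequality for the Legendre pair `x log x - x` and `exp`. -/
lemma mul_le_mul_log_sub_add_exp {x : ℝ} (hx : 0 < x) (A : ℝ) :
    x * A ≤ x * Real.log x - x + Real.exp A := by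
  have h := Real.add_one_le_exp (A - Real.log x)
  rw [Real.exp_sub, Real.exp_log hx, le_div_iff₀ hx] at h
  linarith

lemma mul_log_le_mul_log_sub_add {x t : ℝ} (hx : 0 < x) (ht : 0 < t) :
    x * Real.log t ≤ x * Real.log x - x + t := by
  simpa [Real.exp_log ht] using mul_le_mul_log_sub_add_exp hx (Real.log t)

lemma integrable_comp_of_bounded {X : Type*} [TopologicalSpace X] [MeasurableSpace X]
    [OpensMeasurableSpace X] {μ : Measure X} [IsFiniteMeasure μ]
    {f : X → ℝ} (hf : Continuous f) {C : ℝ} (hC : ∀ x, |f x| ≤ C)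
    {φ : ℝ → ℝ} (hφ : Continuous φ) : Integrable (fun x => φ (f x)) μ := by
  obtain ⟨K, hK⟩ := (isCompact_Icc (a := -C) (b := C)).exists_bound_of_continuousOn
    hφ.continuousOn
  exact Integrable.of_bound (hφ.comp hf).measurable.aestronglyMeasurable K
    (Filter.Eventually.of_forall fun x => hK _ (abs_le.mp (hC x)))

lemma integrable_mul_log_affine {X : Type*} [MeasurableSpace X] {μ : Measure X}
    [IsFiniteMeasure μ] {f : X → ℝ} (hf : Integrable f μ)
    (hfl : Integrable (fun x => f x * Real.log (f x)) μ) (L b c : ℝ) :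
    Integrable (fun x => f x * Real.log (f x) - f x * L + b * f x + c) μ :=
  ((hfl.sub (hf.mul_const _)).add (hf.const_mul b)).add (integrable_const _)

lemma integral_mul_log_affine {X : Type*} [MeasurableSpace X] {μ : Measure X}
    [IsProbabilityMeasure μ] {f : X → ℝ} (hf : Integrable f μ)
    (hfl : Integrable (fun x => f x * Real.log (f x)) μ) (L b c : ℝ) :
    ∫ x, (f x * Real.log (f x) - f x * L + b * f x + c) ∂μ =
      ∫ x, f x * Real.log (f x) ∂μ - (∫ x, f x ∂μ) * L + b * (∫ x, f x ∂μ) + c := by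
  have i1 : Integrable (fun x => f x * Real.log (f x) - f x * L) μ := hfl.sub (hf.mul_const _)
  have i2 : Integrable (fun x => f x * Real.log (f x) - f x * L + b * f x) μ :=
    i1.add (hf.const_mul b)
  rw [integral_add i2 (integrable_const _), integral_add i1 (hf.const_mul b),
    integral_sub hfl (hf.mul_const _), integral_mul_const, integral_const_mul]
  simp

lemma mul_setIntegral_le_entropy {X : Type*} [MeasurableSpace X] {μ : Measure X}
    [IsProbabilityMeasure μ] {f : X → ℝ} (hf : Integrable f μ)
    (hfl : Integrable (fun x => f x * Real.log (f x)) μ) (hpos : ∀ x, 0 < f x)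
    (hZ : 0 < ∫ x, f x ∂μ) {S : Set X} (hS : MeasurableSet S) (A : ℝ) :
    A * ∫ x in S, f x ∂μ ≤ entropy μ f + (∫ x, f x ∂μ) * Real.exp A * μ.real S := by
  unfold entropy
  set Z := ∫ x, f x ∂μ with hZdef
  have hpt : ∀ x, A * S.indicator f x ≤
      f x * Real.log (f x) - f x * Real.log Z + -1 * f x + Z
        + S.indicator (fun _ => Z * Real.exp A) x := by
    intro x
    by_cases hx : x ∈ S
    · have h := mul_le_mul_log_sub_add_exp (hpos x) (A + Real.log Z)
      rw [Real.exp_add, Real.exp_log hZ] at h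
      simp only [Set.indicator_of_mem hx]
      nlinarith
    · have h := mul_log_le_mul_log_sub_add (hpos x) hZ
      simp only [Set.indicator_of_notMem hx]
      linarith
  have hi1 := integrable_mul_log_affine hf hfl (Real.log Z) (-1) Z
  have hi2 : Integrable (S.indicator (fun _ : X => Z * Real.exp A)) μ :=
    (integrable_const _).indicator hS
  have h := integral_mono ((hf.indicator hS).const_mul A) (hi1.add hi2) hpt
  simp only [Pi.add_apply] at h
  rw [integral_const_mul, integral_indicator hS, integral_add hi1 hi2, integral_indicator hS,
    integral_mul_log_affine hf hfl] at h
  simp only [integral_const, smul_eq_mul, measureReal_restrict_apply_univ] at h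
  linarith

lemma sq_mul_log_le {g m a Z : ℝ} (hg : 0 < g) (hm : 0 < m) (ha : 0 < a) (hZ : 0 < Z)
    (hZm : Z ≤ 2 * m ^ 2) :
    g ^ 2 * Real.log (g ^ 2) - g ^ 2 * Real.log (m ^ 2) - g ^ 2 + m ^ 2 ≤
      9 * (g - m) ^ 2 + 4 * (((g - m) ^ 2 + a) * Real.log ((g - m) ^ 2 + a)
        - ((g - m) ^ 2 + a) * Real.log Z + ((g - m) ^ 2 + a) + Z) := by
  have hf : 0 < (g - m) ^ 2 + a := by positivity
  rcases le_or_gt g (2 * m) with h | h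
  · have h1 := mul_log_le_mul_log_sub_add hf hZ
    have h2 : Real.log (g ^ 2) - Real.log (m ^ 2) ≤ g ^ 2 / m ^ 2 - 1 := by
      rw [← Real.log_div (by positivity) (by positivity)]
      exact Real.log_le_sub_one_of_pos (by positivity)
    have h3 := mul_le_mul_of_nonneg_left h2 (sq_nonneg g)
    have h4 : g ^ 2 * (g ^ 2 / m ^ 2 - 1) - g ^ 2 + m ^ 2 ≤ 9 * (g - m) ^ 2 := by
      have : g ^ 2 * (g ^ 2 / m ^ 2 - 1) - g ^ 2 + m ^ 2 =
          (g - m) ^ 2 * ((g + m) ^ 2 / m ^ 2) := by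
        field_simp
        ring
      rw [this]
      have : (g + m) ^ 2 / m ^ 2 ≤ 9 := by
        rw [div_le_iff₀ (by positivity)]
        nlinarith
      nlinarith [sq_nonneg (g - m)]
    linarith
  · have hh : m < g - m := by linarith
    have hmm : m ^ 2 < (g - m) ^ 2 := by nlinarith
    have h1 : Real.log (g ^ 2) ≤ Real.log ((g - m) ^ 2) + 2 := by
      have : Real.log (g ^ 2) ≤ Real.log (4 * (g - m) ^ 2) :=
        Real.log_le_log (by positivity) (by nlinarith)
      rw [Real.log_mul (by norm_num) (by nlinarith)] at this
      have h4 : Real.log 4 ≤ 2 := by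
        rw [show (4:ℝ) = 2 ^ 2 by norm_num, Real.log_pow]
        have := Real.log_two_lt_d9
        push_cast; linarith
      linarith
    have h2 : 0 ≤ Real.log ((g - m) ^ 2) - Real.log (m ^ 2) :=
      sub_nonneg.mpr (Real.log_le_log (by positivity) hmm.le)
    have h3 : Real.log ((g - m) ^ 2) - Real.log (m ^ 2) ≤
        Real.log ((g - m) ^ 2 + a) - Real.log Z + 1 := by
      have e1 : Real.log ((g - m) ^ 2) ≤ Real.log ((g - m) ^ 2 + a) :=
        Real.log_le_log (by nlinarith) (by linarith)
      have e2 : Real.log Z ≤ Real.log (2 * m ^ 2) := Real.log_le_log hZ hZm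
      rw [Real.log_mul (by norm_num) (by positivity)] at e2
      have := Real.log_two_lt_d9
      linarith
    have h5 : g ^ 2 * (Real.log (g ^ 2) - Real.log (m ^ 2)) ≤
        4 * (g - m) ^ 2 * (Real.log ((g - m) ^ 2) - Real.log (m ^ 2) + 2) :=
      (mul_le_mul_of_nonneg_left (by linarith) (sq_nonneg g)).trans
        (mul_le_mul_of_nonneg_right (by nlinarith) (by linarith))
    have h6 : (g - m) ^ 2 * (Real.log ((g - m) ^ 2) - Real.log (m ^ 2)) ≤
        ((g - m) ^ 2 + a) * (Real.log ((g - m) ^ 2 + a) - Real.log Z + 1) :=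
      mul_le_mul (by linarith) h3 h2 hf.le
    nlinarith [sq_nonneg (g - m)]

/-- A substitute for Rothaus' lemma, with non-optimal constants. -/
lemma entropy_sq_le {X : Type*} [TopologicalSpace X] [MeasurableSpace X]
    [OpensMeasurableSpace X] {μ : Measure X} [IsProbabilityMeasure μ]
    {g : X → ℝ} (hg : Continuous g) {C : ℝ} (hC : ∀ x, |g x| ≤ C) (hpos : ∀ x, 0 < g x)
    {m a : ℝ} (hm : 0 < m) (ha : 0 < a) (ham : a ≤ m ^ 2)
    (hs : ∫ x, (g x - m) ^ 2 ∂μ ≤ m ^ 2) (hM : 0 < ∫ x, g x ^ 2 ∂μ) :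
    entropy μ (fun x => g x ^ 2) ≤ 9 * (∫ x, (g x - m) ^ 2 ∂μ) +
      4 * (entropy μ (fun x => (g x - m) ^ 2 + a) + 2 * (∫ x, (g x - m) ^ 2 ∂μ + a)) := by
  have i1 : Integrable (fun x => g x ^ 2) μ :=
    integrable_comp_of_bounded hg hC (φ := fun y => y ^ 2) (by fun_prop)
  have i2 : Integrable (fun x => g x ^ 2 * Real.log (g x ^ 2)) μ :=
    integrable_comp_of_bounded hg hC (φ := fun y => y ^ 2 * Real.log (y ^ 2))
      (Real.continuous_mul_log.comp (continuous_pow 2))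
  have i3 : Integrable (fun x => (g x - m) ^ 2) μ :=
    integrable_comp_of_bounded hg hC (φ := fun y => (y - m) ^ 2) (by fun_prop)
  have i4 : Integrable (fun x => (g x - m) ^ 2 + a) μ := i3.add (integrable_const _)
  have i5 : Integrable (fun x => ((g x - m) ^ 2 + a) * Real.log ((g x - m) ^ 2 + a)) μ :=
    integrable_comp_of_bounded hg hC
      (φ := fun y => ((y - m) ^ 2 + a) * Real.log ((y - m) ^ 2 + a))
      (Real.continuous_mul_log.comp (by fun_prop : Continuous fun y : ℝ => (y - m) ^ 2 + a))
  have hZ : ∫ x, ((g x - m) ^ 2 + a) ∂μ = ∫ x, (g x - m) ^ 2 ∂μ + a := by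
    rw [integral_add i3 (integrable_const _)]; simp
  have hs0 : 0 ≤ ∫ x, (g x - m) ^ 2 ∂μ := integral_nonneg fun x => sq_nonneg _
  unfold entropy
  rw [hZ]
  set s := ∫ x, (g x - m) ^ 2 ∂μ with hsdef
  have hpt : ∀ x, g x ^ 2 * Real.log (g x ^ 2) - g x ^ 2 * Real.log (m ^ 2) + -1 * g x ^ 2
      + m ^ 2 ≤ 9 * (g x - m) ^ 2 + 4 * (((g x - m) ^ 2 + a) * Real.log ((g x - m) ^ 2 + a)
        - ((g x - m) ^ 2 + a) * Real.log (s + a) + 1 * ((g x - m) ^ 2 + a) + (s + a)) := by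
    intro x
    have := sq_mul_log_le (Z := s + a) (hpos x) hm ha (by linarith) (by linarith)
    linarith
  have h := integral_mono (integrable_mul_log_affine i1 i2 (Real.log (m ^ 2)) (-1) (m ^ 2))
    ((i3.const_mul 9).add
      ((integrable_mul_log_affine i4 i5 (Real.log (s + a)) 1 (s + a)).const_mul 4)) hpt
  simp only [Pi.add_apply] at h
  rw [integral_add (i3.const_mul 9)
      ((integrable_mul_log_affine i4 i5 (Real.log (s + a)) 1 (s + a)).const_mul 4),
    integral_const_mul, integral_const_mul, integral_mul_log_affine i1 i2,
    integral_mul_log_affine i4 i5, hZ] at h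
  have := mul_log_le_mul_log_sub_add hM (t := m ^ 2) (by positivity)
  linarith

lemma integral_sq_le_add_two_mul_setIntegral_compl {X : Type*} [MeasurableSpace X]
    {μ : Measure X} [IsProbabilityMeasure μ] {h : X → ℝ} (hi : Integrable h μ)
    (hi2 : Integrable (fun x => h x ^ 2) μ) (h0 : ∫ x, h x ∂μ = 0) {S : Set X}
    (hS : MeasurableSet S) (hq : μ.real Sᶜ ≤ 1 / 2) (k : ℝ) :
    ∫ x, h x ^ 2 ∂μ ≤ ∫ x in S, (h x - k) ^ 2 ∂μ + 2 * ∫ x in Sᶜ, h x ^ 2 ∂μ := by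
  have expand : ∀ (T : Set X) (c : ℝ), ∫ x in T, (h x - c) ^ 2 ∂μ =
      ∫ x in T, h x ^ 2 ∂μ - 2 * c * ∫ x in T, h x ∂μ + c ^ 2 * μ.real T := by
    intro T c
    have j : Integrable (fun x => h x ^ 2 - 2 * c * h x) (μ.restrict T) :=
      hi2.restrict.sub (hi.restrict.const_mul _)
    have : ∀ x, (h x - c) ^ 2 = (h x ^ 2 - 2 * c * h x) + c ^ 2 := fun x => by ring
    simp_rw [this]
    rw [integral_add j (integrable_const _), integral_sub hi2.restrict (hi.restrict.const_mul _),
      integral_const_mul]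
    simp [mul_comm]
  have hsum := integral_add_compl hS hi2
  have hsum1 := integral_add_compl hS hi
  have hp := probReal_add_probReal_compl (μ := μ) hS
  have e1 := expand S k
  set J := ∫ x in Sᶜ, h x ∂μ with hJ
  have e2 := expand Sᶜ (2 * J)
  have n2 : 0 ≤ ∫ x in Sᶜ, (h x - 2 * J) ^ 2 ∂μ := integral_nonneg fun x => sq_nonneg _
  have hI : ∫ x in S, h x ∂μ = -J := by linarith
  rw [hI] at e1
  rw [← hJ] at e2
  nlinarith [sq_nonneg (k + 2 * J), sq_nonneg J, sq_nonneg k]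

lemma norm_gradient {E : Type*} [NormedAddCommGroup E] [InnerProductSpace ℝ E] [CompleteSpace E]
    (f : E → ℝ) (x : E) : ‖gradient f x‖ = ‖fderiv ℝ f x‖ := by
  simp [gradient]

section Euclidean

variable {d : ℕ}

lemma integrable_norm_gradient_sq {μ : Measure (EuclideanSpace ℝ (Fin d))} [IsFiniteMeasure μ]
    {h : EuclideanSpace ℝ (Fin d) → ℝ} (hs : ContDiff ℝ (⊤ : ℕ∞) h) {C : ℝ}
    (hC : ∀ x, ‖gradient h x‖ ≤ C) : Integrable (fun x => ‖gradient h x‖ ^ 2) μ := by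
  refine integrable_comp_of_bounded (C := C) (f := fun x => ‖gradient h x‖) ?_ ?_
    (φ := fun y => y ^ 2) (by fun_prop)
  · simp_rw [norm_gradient]
    exact (hs.continuous_fderiv (by simp)).norm
  · simpa using hC

lemma norm_gradient_sq_add {h : EuclideanSpace ℝ (Fin d) → ℝ} (hs : ContDiff ℝ (⊤ : ℕ∞) h)
    (a : ℝ) (x : EuclideanSpace ℝ (Fin d)) :
    ‖gradient (fun x => h x ^ 2 + a) x‖ = 2 * |h x| * ‖gradient h x‖ := by
  have hd : HasFDerivAt h (fderiv ℝ h x) x :=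
    (hs.differentiable (by simp)).differentiableAt.hasFDerivAt
  rw [norm_gradient, norm_gradient, ((hd.pow 2).add_const a).fderiv, norm_smul]
  simp

lemma memF_sq_add {h : EuclideanSpace ℝ (Fin d) → ℝ} (hs : ContDiff ℝ (⊤ : ℕ∞) h)
    (hC : ∃ C, ∀ x, |h x| ≤ C) (hC' : ∃ C, ∀ x, ‖gradient h x‖ ≤ C) {a : ℝ} (ha : 0 < a) :
    memF fun x => h x ^ 2 + a := by
  obtain ⟨C, hC⟩ := hC
  obtain ⟨C', hC'⟩ := hC'
  refine ⟨(hs.pow 2).add contDiff_const, ⟨C ^ 2 + a, fun x => ?_⟩, ⟨2 * C * C', fun x => ?_⟩,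
    a, ha, fun x => by nlinarith [sq_nonneg (h x)]⟩
  · have := pow_le_pow_left₀ (abs_nonneg _) (hC x) 2
    rw [sq_abs] at this
    rw [abs_of_nonneg (by positivity)]
    linarith
  · rw [norm_gradient_sq_add hs]
    have := (abs_nonneg _).trans (hC x)
    gcongr
    exacts [hC x, hC' x]

lemma gradSq_sq_add_le {h : EuclideanSpace ℝ (Fin d) → ℝ} (hs : ContDiff ℝ (⊤ : ℕ∞) h)
    {a : ℝ} (ha : 0 < a) (x : EuclideanSpace ℝ (Fin d)) :
    gradSq (fun x => h x ^ 2 + a) x ≤ ‖gradient h x‖ ^ 2 := by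
  rw [gradSq, norm_gradient_sq_add hs, div_le_iff₀ (by positivity), mul_pow, mul_pow, sq_abs]
  nlinarith [mul_nonneg ha.le (sq_nonneg ‖gradient h x‖)]

lemma exists_sqrt_of_memF {f : EuclideanSpace ℝ (Fin d) → ℝ} (hf : memF f) :
    ∃ g : EuclideanSpace ℝ (Fin d) → ℝ, ContDiff ℝ (⊤ : ℕ∞) g ∧ (∃ C, ∀ x, |g x| ≤ C) ∧
      (∃ C, ∀ x, ‖gradient g x‖ ≤ C) ∧ (∀ x, 0 < g x) ∧ (∀ x, g x ^ 2 = f x) ∧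
      ∀ x, gradSq f x = ‖gradient g x‖ ^ 2 := by
  obtain ⟨hs, ⟨C, hC⟩, ⟨C', hC'⟩, c, hc, hcf⟩ := hf
  have hpos : ∀ x, 0 < f x := fun x => hc.trans_le (hcf x)
  have hg : ContDiff ℝ (⊤ : ℕ∞) fun x => √(f x) := hs.sqrt fun x => (hpos x).ne'
  have hsq : ∀ x, √(f x) ^ 2 = f x := fun x => Real.sq_sqrt (hpos x).le
  have hgrad : ∀ x, ‖gradient f x‖ = 2 * √(f x) * ‖gradient (fun x => √(f x)) x‖ := by
    intro x
    have h := norm_gradient_sq_add hg 0 x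
    simp_rw [hsq, add_zero] at h
    rwa [abs_of_nonneg (Real.sqrt_nonneg _)] at h
  refine ⟨fun x => √(f x), hg, ⟨√C, fun x => ?_⟩, ⟨C' / (2 * √c), fun x => ?_⟩,
    fun x => Real.sqrt_pos.mpr (hpos x), hsq, fun x => ?_⟩
  · rw [abs_of_nonneg (Real.sqrt_nonneg _)]
    exact Real.sqrt_le_sqrt ((le_abs_self _).trans (hC x))
  · have h1 := hC' x
    rw [hgrad x] at h1
    have h2 : √c ≤ √(f x) := Real.sqrt_le_sqrt (hcf x)
    have h3 : 0 < √c := Real.sqrt_pos.mpr hc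
    rw [le_div_iff₀ (by positivity)]
    nlinarith [norm_nonneg (gradient (fun x => √(f x)) x)]
  · have := hpos x
    rw [gradSq, hgrad, mul_pow, mul_pow, hsq]
    field_simp
    ring

/-- `μ` satisfies the defective log-Sobolev inequality on `memF` with constants `D₁`, `D₂`. -/
def DefectiveLSI (μ : Measure (EuclideanSpace ℝ (Fin d))) (D₁ D₂ : ℝ) : Prop :=
  ∀ f : EuclideanSpace ℝ (Fin d) → ℝ, memF f →
    entropy μ f ≤ D₁ * ∫ x, gradSq f x ∂μ + D₂ * ∫ x, f x ∂μ

lemma DefectiveLSI.entropy_sq_add_le {μ : Measure (EuclideanSpace ℝ (Fin d))}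
    [IsProbabilityMeasure μ] {D₁ D₂ : ℝ} (hμ : DefectiveLSI μ D₁ D₂) (hD₁ : 0 ≤ D₁)
    {h : EuclideanSpace ℝ (Fin d) → ℝ} (hs : ContDiff ℝ (⊤ : ℕ∞) h)
    (hC : ∃ C, ∀ x, |h x| ≤ C) (hC' : ∃ C, ∀ x, ‖gradient h x‖ ≤ C) {a : ℝ} (ha : 0 < a) :
    entropy μ (fun x => h x ^ 2 + a) ≤
      D₁ * ∫ x, ‖gradient h x‖ ^ 2 ∂μ + D₂ * (∫ x, h x ^ 2 ∂μ + a) := by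
  have key := hμ _ (memF_sq_add hs hC hC' ha)
  obtain ⟨C, hC⟩ := hC
  obtain ⟨C', hC'⟩ := hC'
  have hZ : ∫ x, (h x ^ 2 + a) ∂μ = ∫ x, h x ^ 2 ∂μ + a := by
    rw [integral_add (integrable_comp_of_bounded hs.continuous hC (φ := fun y => y ^ 2)
      (by fun_prop)) (integrable_const _)]
    simp
  rw [hZ] at key
  have hle : ∫ x, gradSq (fun x => h x ^ 2 + a) x ∂μ ≤ ∫ x, ‖gradient h x‖ ^ 2 ∂μ :=
    integral_mono_of_nonneg
      (Filter.Eventually.of_forall fun x => div_nonneg (sq_nonneg _) (by positivity))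
      (integrable_norm_gradient_sq hs hC')
      (Filter.Eventually.of_forall fun x => gradSq_sq_add_le hs ha x)
  exact key.trans (by gcongr)

lemma setIntegral_sub_average_sq_le {R β : ℝ} (hR : 0 < R)
    (hβ : ∀ f : EuclideanSpace ℝ (Fin d) → ℝ,
      ContDiff ℝ (⊤ : ℕ∞) f → HasCompactSupport f →
      ∫ x in Metric.closedBall 0 R, f x ^ 2 ≤
        (volume (Metric.closedBall (0 : EuclideanSpace ℝ (Fin d)) R)).toReal⁻¹ *
            (∫ x in Metric.closedBall 0 R, f x) ^ 2 +
          β * ∫ x in Metric.closedBall 0 R, ‖gradient f x‖ ^ 2)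
    {h : EuclideanSpace ℝ (Fin d) → ℝ} (hs : ContDiff ℝ (⊤ : ℕ∞) h) :
    ∃ k, ∫ x in Metric.closedBall 0 R, (h x - k) ^ 2 ≤
      β * ∫ x in Metric.closedBall 0 R, ‖gradient h x‖ ^ 2 := by
  let χ : ContDiffBump (0 : EuclideanSpace ℝ (Fin d)) := ⟨R + 1, R + 2, by linarith, by linarith⟩
  have hχ : ∀ x ∈ Metric.closedBall (0 : EuclideanSpace ℝ (Fin d)) R,
      (fun x => χ x * h x) =ᶠ[nhds x] h := by
    intro x hx
    have : Metric.ball (0 : EuclideanSpace ℝ (Fin d)) (R + 1) ∈ nhds x :=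
      Metric.isOpen_ball.mem_nhds (Metric.closedBall_subset_ball (by linarith) hx)
    filter_upwards [this] with y hy
    rw [χ.one_of_mem_closedBall (Metric.ball_subset_closedBall hy), one_mul]
  have hB : MeasurableSet (Metric.closedBall (0 : EuclideanSpace ℝ (Fin d)) R) :=
    Metric.isClosed_closedBall.measurableSet
  have key := hβ (fun x => χ x * h x) (χ.contDiff.mul hs) (χ.hasCompactSupport.mul_right)
  rw [setIntegral_congr_fun hB (g := fun x => h x ^ 2)
      (fun x hx => by simp only [(hχ x hx).eq_of_nhds]),
    setIntegral_congr_fun hB (g := h) (fun x hx => (hχ x hx).eq_of_nhds),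
    setIntegral_congr_fun hB (f := fun x => ‖gradient (fun x => χ x * h x) x‖ ^ 2)
      (g := fun x => ‖gradient h x‖ ^ 2)
      (fun x hx => by simp only [gradient, (hχ x hx).fderiv_eq])] at key
  have hfin : volume (Metric.closedBall (0 : EuclideanSpace ℝ (Fin d)) R) ≠ ⊤ :=
    measure_closedBall_lt_top.ne
  have hpos : 0 < (volume (Metric.closedBall (0 : EuclideanSpace ℝ (Fin d)) R)).toReal :=
    ENNReal.toReal_pos (Metric.measure_closedBall_pos _ _ hR).ne' hfin
  have i1 : IntegrableOn h (Metric.closedBall 0 R) :=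
    hs.continuous.continuousOn.integrableOn_compact (isCompact_closedBall _ _)
  have i2 : IntegrableOn (fun x => h x ^ 2) (Metric.closedBall 0 R) :=
    (hs.continuous.pow 2).continuousOn.integrableOn_compact (isCompact_closedBall _ _)
  set v := (volume (Metric.closedBall (0 : EuclideanSpace ℝ (Fin d)) R)).toReal with hv
  set I := ∫ x in Metric.closedBall 0 R, h x with hI
  refine ⟨v⁻¹ * I, ?_⟩
  have i3 : IntegrableOn (fun x => h x ^ 2 - 2 * (v⁻¹ * I) * h x) (Metric.closedBall 0 R) :=
    i2.sub (i1.const_mul _)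
  have i4 : IntegrableOn (fun _ => (v⁻¹ * I) ^ 2)
      (Metric.closedBall (0 : EuclideanSpace ℝ (Fin d)) R) :=
    integrableOn_const hfin
  have : ∀ x, (h x - v⁻¹ * I) ^ 2 = (h x ^ 2 - 2 * (v⁻¹ * I) * h x) + (v⁻¹ * I) ^ 2 :=
    fun x => by ring
  simp_rw [this]
  rw [integral_add i3 i4, integral_sub i2 (i1.const_mul _), integral_const_mul, setIntegral_const,
    ← hI, measureReal_def, ← hv, smul_eq_mul]
  have e : v * (v⁻¹ * I) ^ 2 = v⁻¹ * I ^ 2 := by field_simp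
  rw [e]
  linarith

lemma withDensity_restrict_le {X : Type*} [MeasurableSpace X] {ν : Measure X} {ρ : X → ENNReal}
    {S : Set X} (hS : MeasurableSet S) {C : ENNReal} (hC : ∀ᵐ x ∂ν.restrict S, ρ x ≤ C) :
    (ν.withDensity ρ).restrict S ≤ C • ν.restrict S := by
  rw [restrict_withDensity hS]
  refine (withDensity_mono hC).trans ?_
  rw [withDensity_const]

lemma le_withDensity_restrict {X : Type*} [MeasurableSpace X] {ν : Measure X} {ρ : X → ENNReal}
    {S : Set X} (hS : MeasurableSet S) {C : ENNReal} (hC : ∀ᵐ x ∂ν.restrict S, C ≤ ρ x) :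
    C • ν.restrict S ≤ (ν.withDensity ρ).restrict S := by
  rw [restrict_withDensity hS, ← withDensity_const]
  exact withDensity_mono hC

/-- The Poincaré inequality for a measure with density bounded above and below on a ball that
carries most of its mass, given a defective log-Sobolev inequality. -/
lemma DefectiveLSI.poincare {ρ : EuclideanSpace ℝ (Fin d) → ℝ}
    {μ : Measure (EuclideanSpace ℝ (Fin d))} [IsProbabilityMeasure μ]
    (hdens : μ = volume.withDensity fun x => ENNReal.ofReal (ρ x))
    {D₁ D₂ : ℝ} (hD₁ : 0 ≤ D₁) (hD₂ : 0 ≤ D₂) (hμ : DefectiveLSI μ D₁ D₂)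
    {R β C₁ C₂ : ℝ} (hR : 0 < R) (hβ0 : 0 ≤ β)
    (hβ : ∀ f : EuclideanSpace ℝ (Fin d) → ℝ,
      ContDiff ℝ (⊤ : ℕ∞) f → HasCompactSupport f →
      ∫ x in Metric.closedBall 0 R, f x ^ 2 ≤
        (volume (Metric.closedBall (0 : EuclideanSpace ℝ (Fin d)) R)).toReal⁻¹ *
            (∫ x in Metric.closedBall 0 R, f x) ^ 2 +
          β * ∫ x in Metric.closedBall 0 R, ‖gradient f x‖ ^ 2)
    (hmass : μ.real (Metric.closedBall 0 R)ᶜ ≤ min (1 / 2) (Real.exp (-(16 * (D₂ + 1)))))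
    (hC₁ : 0 < C₁) (hC₂ : 0 ≤ C₂)
    (hbdd : ∀ᵐ x ∂(volume.restrict (Metric.closedBall (0 : EuclideanSpace ℝ (Fin d)) R)),
        C₁ ≤ ρ x ∧ ρ x ≤ C₂)
    {h : EuclideanSpace ℝ (Fin d) → ℝ} (hs : ContDiff ℝ (⊤ : ℕ∞) h)
    (hC : ∃ C, ∀ x, |h x| ≤ C) (hC' : ∃ C, ∀ x, ‖gradient h x‖ ≤ C)
    (h0 : ∫ x, h x ∂μ = 0) :
    ∫ x, h x ^ 2 ∂μ ≤ 2 * (C₂ * β / C₁ + 2 * D₁) * ∫ x, ‖gradient h x‖ ^ 2 ∂μ := by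
  have hB : MeasurableSet (Metric.closedBall (0 : EuclideanSpace ℝ (Fin d)) R) :=
    Metric.isClosed_closedBall.measurableSet
  have ent := fun a ha => hμ.entropy_sq_add_le hD₁ hs hC hC' (a := a) ha
  obtain ⟨C, hC⟩ := hC
  obtain ⟨C', hC'⟩ := hC'
  have ig := integrable_norm_gradient_sq (μ := μ) hs hC'
  have i1 : Integrable h μ := integrable_comp_of_bounded hs.continuous hC continuous_id
  have i2 : Integrable (fun x => h x ^ 2) μ :=
    integrable_comp_of_bounded hs.continuous hC (φ := fun y => y ^ 2) (by fun_prop)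
  obtain ⟨k, hk⟩ := setIntegral_sub_average_sq_le hR hβ hs
  have hloc : ∫ x in Metric.closedBall 0 R, (h x - k) ^ 2 ∂μ ≤
      C₂ * β / C₁ * ∫ x, ‖gradient h x‖ ^ 2 ∂μ := by
    have u1 : μ.restrict (Metric.closedBall 0 R) ≤
        ENNReal.ofReal C₂ • volume.restrict (Metric.closedBall 0 R) := by
      rw [hdens]
      exact withDensity_restrict_le hB (hbdd.mono fun x hx => ENNReal.ofReal_le_ofReal hx.2)
    have u2 : ENNReal.ofReal C₁ • volume.restrict (Metric.closedBall 0 R) ≤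
        μ.restrict (Metric.closedBall 0 R) := by
      rw [hdens]
      exact le_withDensity_restrict hB (hbdd.mono fun x hx => ENNReal.ofReal_le_ofReal hx.1)
    have ik : IntegrableOn (fun x => (h x - k) ^ 2) (Metric.closedBall 0 R) :=
      ((hs.continuous.sub continuous_const).pow 2).continuousOn.integrableOn_compact
        (isCompact_closedBall _ _)
    have v1 := integral_mono_measure u1 (Filter.Eventually.of_forall fun x => sq_nonneg (h x - k))
      (ik.smul_measure ENNReal.ofReal_ne_top)
    have v2 := integral_mono_measure u2
      (Filter.Eventually.of_forall fun x => sq_nonneg ‖gradient h x‖) ig.restrict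
    rw [integral_smul_measure, ENNReal.toReal_ofReal hC₂, smul_eq_mul] at v1
    rw [integral_smul_measure, ENNReal.toReal_ofReal hC₁.le, smul_eq_mul] at v2
    have v3 : ∫ x in Metric.closedBall 0 R, ‖gradient h x‖ ^ 2 ∂μ ≤
        ∫ x, ‖gradient h x‖ ^ 2 ∂μ :=
      setIntegral_le_integral ig (Filter.Eventually.of_forall fun x => sq_nonneg _)
    have v4 : ∫ x in Metric.closedBall 0 R, ‖gradient h x‖ ^ 2 ≤
        (∫ x, ‖gradient h x‖ ^ 2 ∂μ) / C₁ := by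
      rw [le_div_iff₀ hC₁]
      linarith
    calc _ ≤ _ := v1
      _ ≤ C₂ * (β * ((∫ x, ‖gradient h x‖ ^ 2 ∂μ) / C₁)) := by
        gcongr
        exact hk.trans (by gcongr)
      _ = _ := by ring
  have hsplit := integral_sq_le_add_two_mul_setIntegral_compl i1 i2 h0 hB
    (hmass.trans (min_le_left _ _)) k
  have hE : 0 ≤ ∫ x, ‖gradient h x‖ ^ 2 ∂μ := integral_nonneg fun x => sq_nonneg _
  have hs0 : 0 ≤ ∫ x, h x ^ 2 ∂μ := integral_nonneg fun x => sq_nonneg _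
  refine le_of_forall_pos_le_add fun a ha => ?_
  have i4 : Integrable (fun x => h x ^ 2 + a) μ := i2.add (integrable_const _)
  have hZ : ∫ x, (h x ^ 2 + a) ∂μ = ∫ x, h x ^ 2 ∂μ + a := by
    rw [integral_add i2 (integrable_const _)]
    simp
  have tail := mul_setIntegral_le_entropy i4
    (integrable_comp_of_bounded hs.continuous hC
      (φ := fun y => (y ^ 2 + a) * Real.log (y ^ 2 + a))
      (Real.continuous_mul_log.comp (by fun_prop : Continuous fun y : ℝ => y ^ 2 + a)))
    (fun x => by positivity) (by rw [hZ]; positivity) hB.compl (16 * (D₂ + 1))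
  rw [hZ] at tail
  have hq : Real.exp (16 * (D₂ + 1)) * μ.real (Metric.closedBall 0 R)ᶜ ≤ 1 := by
    calc _ ≤ Real.exp (16 * (D₂ + 1)) * Real.exp (-(16 * (D₂ + 1))) := by
          gcongr
          exact hmass.trans (min_le_right _ _)
      _ = 1 := by rw [← Real.exp_add]; simp
  have hQ : ∫ x in (Metric.closedBall 0 R)ᶜ, h x ^ 2 ∂μ ≤
      ∫ x in (Metric.closedBall 0 R)ᶜ, (h x ^ 2 + a) ∂μ :=
    integral_mono i2.restrict i4.restrict fun x => by simpa using ha.le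
  have hent := ent a ha
  set s := ∫ x, h x ^ 2 ∂μ
  set E := ∫ x, ‖gradient h x‖ ^ 2 ∂μ
  set Q := ∫ x in (Metric.closedBall 0 R)ᶜ, h x ^ 2 ∂μ
  have hq' := mul_le_mul_of_nonneg_left hq (by positivity : 0 ≤ s + a)
  have hQ' := mul_le_mul_of_nonneg_left hQ (by positivity : 0 ≤ 16 * (D₂ + 1))
  have hfin : 16 * (D₂ + 1) * Q ≤ (D₂ + 1) * (D₁ * E + (s + a)) := by
    nlinarith [mul_nonneg hD₂ (mul_nonneg hD₁ hE)]
  have hfin' : 16 * Q ≤ D₁ * E + (s + a) := by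
    refine le_of_mul_le_mul_left ?_ (by positivity : 0 < D₂ + 1)
    linarith
  have hP : 0 ≤ C₂ * β / C₁ * E := by positivity
  have hDE : 0 ≤ D₁ * E := by positivity
  linarith

lemma DefectiveLSI.entropy_le_of_poincare {μ : Measure (EuclideanSpace ℝ (Fin d))}
    [IsProbabilityMeasure μ] {D₁ D₂ P : ℝ} (hD₁ : 0 ≤ D₁) (hD₂ : 0 ≤ D₂) (hP0 : 0 ≤ P)
    (hμ : DefectiveLSI μ D₁ D₂)
    (hP : ∀ h : EuclideanSpace ℝ (Fin d) → ℝ, ContDiff ℝ (⊤ : ℕ∞) h →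
      (∃ C, ∀ x, |h x| ≤ C) → (∃ C, ∀ x, ‖gradient h x‖ ≤ C) → ∫ x, h x ∂μ = 0 →
      ∫ x, h x ^ 2 ∂μ ≤ P * ∫ x, ‖gradient h x‖ ^ 2 ∂μ)
    {f : EuclideanSpace ℝ (Fin d) → ℝ} (hf : memF f) :
    entropy μ f ≤ (4 * D₁ + (4 * D₂ + 17) * P) * ∫ x, gradSq f x ∂μ := by
  have hd := hμ f hf
  obtain ⟨g, hs, ⟨C, hC⟩, ⟨C', hC'⟩, hpos, hsq, hgrad⟩ := exists_sqrt_of_memF hf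
  obtain rfl : (fun x => g x ^ 2) = f := funext hsq
  simp_rw [hgrad] at hd ⊢
  have i1 : Integrable g μ := integrable_comp_of_bounded hs.continuous hC continuous_id
  have i2 : Integrable (fun x => g x ^ 2) μ :=
    integrable_comp_of_bounded hs.continuous hC (φ := fun y => y ^ 2) (by fun_prop)
  have hm : 0 < ∫ x, g x ∂μ := by
    rw [integral_pos_iff_support_of_nonneg (fun x => (hpos x).le) i1,
      Function.support_eq_univ fun x => (hpos x).ne', measure_univ]
    exact one_pos
  set m := ∫ x, g x ∂μ with hmdef
  have hhs : ContDiff ℝ (⊤ : ℕ∞) fun x => g x - m := hs.sub contDiff_const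
  have hhg : ∀ x, gradient (fun x => g x - m) x = gradient g x := fun x => by
    simp [gradient, fderiv_sub_const]
  have hhC : ∃ K, ∀ x, |g x - m| ≤ K := ⟨C + |m|, fun x => (abs_sub _ _).trans (by
    gcongr
    exact hC x)⟩
  have hhC' : ∃ K, ∀ x, ‖gradient (fun x => g x - m) x‖ ≤ K := ⟨C', fun x => by
    rw [hhg]
    exact hC' x⟩
  have ent := fun a ha => hμ.entropy_sq_add_le hD₁ hhs hhC hhC' (a := a) ha
  have hvar := hP _ hhs hhC hhC' (by
    rw [integral_sub i1 (integrable_const _)]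
    simp [← hmdef])
  simp_rw [hhg] at hvar ent
  have hM : ∫ x, g x ^ 2 ∂μ = m ^ 2 + ∫ x, (g x - m) ^ 2 ∂μ := by
    have e : ∀ x, (g x - m) ^ 2 = (g x ^ 2 - 2 * m * g x) + m ^ 2 := fun x => by ring
    have i3 : Integrable (fun x => g x ^ 2 - 2 * m * g x) μ := i2.sub (i1.const_mul _)
    simp_rw [e]
    rw [integral_add i3 (integrable_const _), integral_sub i2 (i1.const_mul _),
      integral_const_mul, ← hmdef]
    simp
    ring
  have hE : 0 ≤ ∫ x, ‖gradient g x‖ ^ 2 ∂μ := integral_nonneg fun x => sq_nonneg _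
  have hs0 : 0 ≤ ∫ x, (g x - m) ^ 2 ∂μ := integral_nonneg fun x => sq_nonneg _
  have hrot := fun a ha ham hsm => entropy_sq_le (μ := μ) hs.continuous hC hpos (a := a) hm ha ham
    hsm (by rw [hM]; positivity)
  rw [hM] at hd
  set s := ∫ x, (g x - m) ^ 2 ∂μ
  set E := ∫ x, ‖gradient g x‖ ^ 2 ∂μ
  have hDE : 0 ≤ D₁ * E := by positivity
  have hDv : D₂ * s ≤ D₂ * (P * E) := by gcongr
  rcases le_or_gt s (m ^ 2) with hsm | hsm
  · have hlim : ∀ a, 0 < a → a ≤ m ^ 2 →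
        entropy μ (fun x => g x ^ 2) ≤ 17 * s + 4 * D₁ * E + 4 * D₂ * s + 4 * (D₂ + 2) * a := by
      intro a ha ham
      have h1 := hrot a ha ham hsm
      have h2 := ent a ha
      linarith
    have : entropy μ (fun x => g x ^ 2) ≤ 17 * s + 4 * D₁ * E + 4 * D₂ * s := by
      refine le_of_forall_pos_le_add fun ε hε => ?_
      have hK : 0 < 4 * (D₂ + 2) := by positivity
      refine (hlim (min (m ^ 2) (ε / (4 * (D₂ + 2)))) (by positivity) (min_le_left _ _)).trans ?_
      gcongr
      rw [← le_div_iff₀' hK]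
      exact min_le_right _ _
    linarith
  · have : D₂ * m ^ 2 ≤ D₂ * s := by gcongr
    have : 0 ≤ D₂ * (P * E) := by positivity
    have : 0 ≤ P * E := by positivity
    linarith

end Euclidean

theorem stmt_2 {d : ℕ} {Θ : Type*} [Nonempty Θ]
    (μ : Θ → Measure (EuclideanSpace ℝ (Fin d)))
    (hprob : ∀ θ, IsProbabilityMeasure (μ θ))
    (ρ : Θ → EuclideanSpace ℝ (Fin d) → ℝ)
    (hdens : ∀ θ, μ θ = volume.withDensity fun x => ENNReal.ofReal (ρ θ x))
    (htight : ∀ ε > (0:ℝ), ∃ R > (0:ℝ), ∀ θ,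
      1 - ε ≤ ((μ θ) (Metric.closedBall 0 R)).toReal)
    (hbdd : ∀ R > (0:ℝ), ∃ C₁ C₂ : ℝ, 0 < C₁ ∧ C₁ ≤ C₂ ∧ ∀ θ,
      ∀ᵐ x ∂(volume.restrict (Metric.closedBall (0 : EuclideanSpace ℝ (Fin d)) R)),
        C₁ ≤ ρ θ x ∧ ρ θ x ≤ C₂)
    (hpoin : ∀ R > (0:ℝ), ∃ β > (0:ℝ), ∀ f : EuclideanSpace ℝ (Fin d) → ℝ,
      ContDiff ℝ (⊤ : ℕ∞) f → HasCompactSupport f →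
      ∫ x in Metric.closedBall 0 R, f x ^ 2 ≤
        (volume (Metric.closedBall (0 : EuclideanSpace ℝ (Fin d)) R)).toReal⁻¹ *
            (∫ x in Metric.closedBall 0 R, f x) ^ 2 +
          β * ∫ x in Metric.closedBall 0 R, ‖gradient f x‖ ^ 2)
    (D₁ D₂ : ℝ) (hD₁ : 0 ≤ D₁) (hD₂ : 0 ≤ D₂)
    (hdls : ∀ θ, ∀ f : EuclideanSpace ℝ (Fin d) → ℝ, memF f →
      ∫ x, f x * Real.log (f x) ∂(μ θ) -
          (∫ x, f x ∂(μ θ)) * Real.log (∫ x, f x ∂(μ θ)) ≤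
        D₁ * ∫ x, gradSq f x ∂(μ θ) + D₂ * ∫ x, f x ∂(μ θ)) :
    ∃ C : ℝ, 0 ≤ C ∧ ∀ θ, ∀ f : EuclideanSpace ℝ (Fin d) → ℝ, memF f →
      ∫ x, f x * Real.log (f x) ∂(μ θ) -
          (∫ x, f x ∂(μ θ)) * Real.log (∫ x, f x ∂(μ θ)) ≤
        C * ∫ x, gradSq f x ∂(μ θ) := by
  obtain ⟨R, hR, hmass⟩ := htight (min (1 / 2) (Real.exp (-(16 * (D₂ + 1)))))
    (lt_min (by norm_num) (Real.exp_pos _))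
  obtain ⟨C₁, C₂, hC₁, hC₁₂, hρ⟩ := hbdd R hR
  obtain ⟨β, hβ0, hβ⟩ := hpoin R hR
  have hC₂ : 0 ≤ C₂ := hC₁.le.trans hC₁₂
  have hP : 0 ≤ 2 * (C₂ * β / C₁ + 2 * D₁) := by positivity
  refine ⟨4 * D₁ + (4 * D₂ + 17) * (2 * (C₂ * β / C₁ + 2 * D₁)), by positivity,
    fun θ f hf => ?_⟩
  have := hprob θ
  have hμ : DefectiveLSI (μ θ) D₁ D₂ := hdls θ
  have hcompl : (μ θ).real (Metric.closedBall 0 R)ᶜ ≤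
      min (1 / 2) (Real.exp (-(16 * (D₂ + 1)))) := by
    rw [probReal_compl_eq_one_sub Metric.isClosed_closedBall.measurableSet, measureReal_def]
    linarith [hmass θ]
  exact hμ.entropy_le_of_poincare hD₁ hD₂ hP (fun h hs hC hC' h0 =>
    hμ.poincare (hdens θ) hD₁ hD₂ hR hβ0.le hβ hcompl hC₁ hC₂ (hρ θ) hs hC hC' h0) hf
end

section
/- Let μ be a Borel probability measure on ℝ^d, absolutely continuous with respect to Lebesgue measure with density ρ. Let R > 0 and 0 < C₁ ≤ C₂ be such that C₁ ≤ ρ(x) ≤ C₂ for (Lebesgue-)a.e. x ∈ B_R, let ε ∈ (0,1) be such that μ(B_R) ≥ 1 − ε, and let β > 0 be such that ∫_{B_R} f² dx ≤ |B_R|^{-1} (∫_{B_R} f dx)² + β ∫_{B_R} |∇f|² dx for every f ∈ C_c^∞(ℝ^d). Then for every f ∈ C_c^∞(ℝ^d) with ∫ f dμ = 0, one has ∫ f² dμ ≤ (β C₂ / C₁) ∫ |∇f|² dμ + (ε/(1−ε)) ‖f‖_∞². -/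
open MeasureTheory

theorem restrict_withDensity_bounds {α : Type*} [MeasurableSpace α] {ν : Measure α} {ρ : α → ℝ}
    {s : Set α} (hs : MeasurableSet s) {a b : ℝ}
    (h : ∀ᵐ x ∂(ν.restrict s), a ≤ ρ x ∧ ρ x ≤ b) :
    ENNReal.ofReal a • ν.restrict s ≤
        (ν.withDensity fun x => ENNReal.ofReal (ρ x)).restrict s ∧
      (ν.withDensity fun x => ENNReal.ofReal (ρ x)).restrict s ≤
        ENNReal.ofReal b • ν.restrict s := by
  rw [restrict_withDensity hs, ← withDensity_const, ← withDensity_const]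
  exact ⟨withDensity_mono (h.mono fun x hx => ENNReal.ofReal_le_ofReal hx.1),
    withDensity_mono (h.mono fun x hx => ENNReal.ofReal_le_ofReal hx.2)⟩

theorem integral_sub_const_sq {α : Type*} [MeasurableSpace α] {ν : Measure α} [IsFiniteMeasure ν]
    {f : α → ℝ} (hf : Integrable f ν) (hf2 : Integrable (fun x => f x ^ 2) ν) (c : ℝ) :
    ∫ x, (f x - c) ^ 2 ∂ν = ∫ x, f x ^ 2 ∂ν - 2 * c * ∫ x, f x ∂ν + c ^ 2 * ν.real Set.univ := by
  have h : ∀ x, (f x - c) ^ 2 = f x ^ 2 - 2 * c * f x + c ^ 2 := fun x => by ring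
  simp_rw [h]
  have hd : Integrable (fun x => f x ^ 2 - 2 * c * f x) ν := hf2.sub (hf.const_mul _)
  rw [integral_add hd (integrable_const _),
    integral_sub hf2 (hf.const_mul _), integral_const_mul, integral_const, smul_eq_mul]
  ring

theorem setIntegral_sq_le_of_variance_le {α : Type*} [MeasurableSpace α] {μ : Measure α}
    [IsProbabilityMeasure μ] {f : α → ℝ} (hf : Integrable f μ)
    (hf2 : Integrable (fun x => f x ^ 2) μ) (hf0 : ∫ x, f x ∂μ = 0) {M : ℝ}
    (hM : ∀ x, |f x| ≤ M) {s : Set α} (hs : MeasurableSet s) {ε : ℝ} (hε : ε < 1)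
    (hμs : 1 - ε ≤ μ.real s) (c : ℝ) :
    ∫ x, f x ^ 2 ∂μ ≤ ∫ x in s, (f x - c) ^ 2 ∂μ + ε / (1 - ε) * M ^ 2 := by
  have e1 := integral_add_compl hs hf
  have e2 := integral_add_compl hs hf2
  have e3 := integral_sub_const_sq (ν := μ.restrict s) hf.restrict hf2.restrict c
  have hc : μ.real sᶜ = 1 - μ.real s := by rw [measureReal_compl hs]; simp
  have b1 : |∫ x in sᶜ, f x ∂μ| ≤ M * μ.real sᶜ := by
    rw [← Real.norm_eq_abs]
    exact norm_setIntegral_le_of_norm_le_const (measure_lt_top _ _) fun x _ => hM x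
  have b2 : ∫ x in sᶜ, f x ^ 2 ∂μ ≤ M ^ 2 * μ.real sᶜ :=
    (le_abs_self _).trans <| norm_setIntegral_le_of_norm_le_const (C := M ^ 2)
      (measure_lt_top _ _) fun x _ => by
        rw [Real.norm_eq_abs, abs_pow]
        exact pow_le_pow_left₀ (abs_nonneg _) (hM x) 2
  rw [hc] at b1 b2
  rw [measureReal_restrict_apply_univ] at e3
  set m := μ.real s
  have hm : 0 < m := by linarith
  set I := ∫ x in s, f x ∂μ
  have b3 : I ^ 2 ≤ (M * (1 - m)) ^ 2 := by
    rw [show I = -∫ x in sᶜ, f x ∂μ by linarith, neg_sq]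
    exact sq_le_sq.2 (b1.trans (le_abs_self _))
  have b4 : 2 * c * I - c ^ 2 * m ≤ (M * (1 - m)) ^ 2 / m := by
    rw [le_div_iff₀ hm]
    nlinarith [sq_nonneg (I - c * m)]
  have b5 : (1 - m) / m ≤ ε / (1 - ε) := by
    rw [div_le_div_iff₀ hm (by linarith)]
    nlinarith
  have b6 : M ^ 2 * (1 - m) + (M * (1 - m)) ^ 2 / m = (1 - m) / m * M ^ 2 := by
    field_simp
    ring
  have b7 := mul_le_mul_of_nonneg_right b5 (sq_nonneg M)
  linarith

theorem stmt_3 {d : ℕ}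
    (μ : Measure (EuclideanSpace ℝ (Fin d))) (hμ : IsProbabilityMeasure μ)
    (ρ : EuclideanSpace ℝ (Fin d) → ℝ)
    (hdens : μ = volume.withDensity fun x => ENNReal.ofReal (ρ x))
    (R C₁ C₂ : ℝ) (hR : 0 < R) (hC₁ : 0 < C₁) (hC₁₂ : C₁ ≤ C₂)
    (hbdd : ∀ᵐ x ∂(volume.restrict (Metric.closedBall (0 : EuclideanSpace ℝ (Fin d)) R)),
      C₁ ≤ ρ x ∧ ρ x ≤ C₂)
    (ε : ℝ) (hε : ε ∈ Set.Ioo (0:ℝ) 1)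
    (hμR : 1 - ε ≤ (μ (Metric.closedBall 0 R)).toReal)
    (β : ℝ) (hβ : 0 < β)
    (hpoin : ∀ f : EuclideanSpace ℝ (Fin d) → ℝ,
      ContDiff ℝ (⊤ : ℕ∞) f → HasCompactSupport f →
      ∫ x in Metric.closedBall 0 R, f x ^ 2 ≤
        (volume (Metric.closedBall (0 : EuclideanSpace ℝ (Fin d)) R)).toReal⁻¹ *
            (∫ x in Metric.closedBall 0 R, f x) ^ 2 +
          β * ∫ x in Metric.closedBall 0 R, ‖gradient f x‖ ^ 2)
    (f : EuclideanSpace ℝ (Fin d) → ℝ) (hf : ContDiff ℝ (⊤ : ℕ∞) f)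
    (hfc : HasCompactSupport f) (hf0 : ∫ x, f x ∂μ = 0) :
    ∫ x, f x ^ 2 ∂μ ≤
      β * C₂ / C₁ * ∫ x, ‖gradient f x‖ ^ 2 ∂μ + ε / (1 - ε) * (⨆ x, |f x|) ^ 2 := by
  have hgrad : ∀ x, ‖gradient f x‖ = ‖fderiv ℝ f x‖ := fun x =>
    LinearIsometryEquiv.norm_map _ _
  have hP := hpoin f hf hfc
  simp_rw [hgrad] at hP ⊢
  set B := Metric.closedBall (0 : EuclideanSpace ℝ (Fin d)) R with hB
  have hBm : MeasurableSet B := Metric.isClosed_closedBall.measurableSet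
  obtain ⟨hlow, hup⟩ := restrict_withDensity_bounds hBm hbdd
  rw [← hdens] at hlow hup
  have hBc : IsCompact B := isCompact_closedBall _ _
  have : IsFiniteMeasure (volume.restrict B) := ⟨by simpa using hBc.measure_lt_top⟩
  have hv : 0 < (volume B).toReal :=
    ENNReal.toReal_pos (Metric.measure_closedBall_pos _ _ hR).ne' hBc.measure_lt_top.ne
  have hcont : Continuous f := hf.continuous
  have hgc : Continuous fun x => ‖fderiv ℝ f x‖ ^ 2 :=
    (hf.continuous_fderiv (by simp)).norm.pow 2
  have hgs : HasCompactSupport fun x => ‖fderiv ℝ f x‖ ^ 2 :=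
    (hfc.fderiv ℝ).comp_left (g := fun L => ‖L‖ ^ 2) (by simp)
  have hf2s : HasCompactSupport fun x => f x ^ 2 :=
    hfc.comp_left (g := fun t : ℝ => t ^ 2) (by simp)
  have hgμ : Integrable (fun x => ‖fderiv ℝ f x‖ ^ 2) μ := hgc.integrable_of_hasCompactSupport hgs
  have hbd : BddAbove (Set.range fun x => |f x|) := by
    obtain ⟨K, hK⟩ := hfc.exists_bound_of_continuous hcont
    exact ⟨K, by rintro _ ⟨x, rfl⟩; exact hK x⟩
  set c := (volume B).toReal⁻¹ * ∫ x in B, f x with hc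
  have key := setIntegral_sq_le_of_variance_le (hcont.integrable_of_hasCompactSupport hfc)
    ((hcont.pow 2).integrable_of_hasCompactSupport hf2s) hf0 (le_ciSup hbd) hBm hε.2 hμR c
  have hvar := integral_sub_const_sq (ν := volume.restrict B)
    (hcont.integrable_of_hasCompactSupport hfc)
    ((hcont.pow 2).integrable_of_hasCompactSupport hf2s) c
  have hC₂ : 0 ≤ C₂ := hC₁.le.trans hC₁₂
  have h1 : ∫ x in B, (f x - c) ^ 2 ∂μ ≤ C₂ * ∫ x in B, (f x - c) ^ 2 := by
    have hi : Integrable (fun x => (f x - c) ^ 2) (volume.restrict B) :=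
      ((hcont.sub continuous_const).pow 2).continuousOn.integrableOn_compact hBc
    have := integral_mono_measure hup (ae_of_all _ fun x => sq_nonneg (f x - c))
      (hi.smul_measure ENNReal.ofReal_ne_top)
    rwa [integral_smul_measure, ENNReal.toReal_ofReal hC₂, smul_eq_mul] at this
  have h2 : C₁ * ∫ x in B, ‖fderiv ℝ f x‖ ^ 2 ≤ ∫ x, ‖fderiv ℝ f x‖ ^ 2 ∂μ := by
    have := integral_mono_measure (hlow.trans Measure.restrict_le_self)
      (ae_of_all _ fun x => sq_nonneg ‖fderiv ℝ f x‖) hgμ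
    rwa [integral_smul_measure, ENNReal.toReal_ofReal hC₁.le, smul_eq_mul] at this
  have h3 : ∫ x in B, (f x - c) ^ 2 ≤ β * ∫ x in B, ‖fderiv ℝ f x‖ ^ 2 := by
    rw [measureReal_restrict_apply_univ, measureReal_def] at hvar
    have : ∀ I : ℝ, 2 * ((volume B).toReal⁻¹ * I) * I -
        ((volume B).toReal⁻¹ * I) ^ 2 * (volume B).toReal = (volume B).toReal⁻¹ * I ^ 2 := by
      intro I
      field_simp
      ring
    have := this (∫ x in B, f x)
    rw [← hc] at this
    linarith
  have h4 : C₂ * (β * ∫ x in B, ‖fderiv ℝ f x‖ ^ 2) ≤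
      β * C₂ / C₁ * ∫ x, ‖fderiv ℝ f x‖ ^ 2 ∂μ := by
    calc C₂ * (β * ∫ x in B, ‖fderiv ℝ f x‖ ^ 2)
        = β * C₂ / C₁ * (C₁ * ∫ x in B, ‖fderiv ℝ f x‖ ^ 2) := by field_simp
      _ ≤ _ := mul_le_mul_of_nonneg_left h2 (by positivity)
  have h5 := mul_le_mul_of_nonneg_left h3 hC₂
  linarith
end

section
/- Let κ be a Markov kernel on ℝ^d, γ a Borel probability measure on ℝ^d, and constants c ≥ 0, κ₀ ≥ 0, L₀ ≥ 0. Assume: (i) for every f ∈ F and every x ∈ ℝ^d, κ(f log f)(x) − (κf)(x) log (κf)(x) ≤ 2c · κ(|∇f|²/(4f))(x); (ii) for every f ∈ F the function κf is differentiable and |∇(κf)(x)| ≤ κ₀ · κ(|∇f|)(x) for all x ∈ ℝ^d; (iii) γ satisfies the log-Sobolev inequality: for every g that is bounded, differentiable with bounded gradient and with inf g > 0, ∫ g log g dγ ≤ (∫ g dγ) log(∫ g dγ) + 2 L₀ ∫ |∇g|²/(4g) dγ. Then the probability measure γκ satisfies: for every f ∈ F, ∫ f log f d(γκ) − (∫ f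 d(γκ)) log(∫ f d(γκ)) ≤ 2 (L₀ κ₀² + c) ∫ |∇f|²/(4f) d(γκ). -/
open MeasureTheory

/-- Cauchy-Schwarz in the form `(∫ u)² / ∫ v ≤ ∫ u² / v`. -/
theorem sq_integral_div_integral_le {α : Type*} [MeasurableSpace α] {μ : Measure α}
    {u v : α → ℝ} (hu : Integrable u μ) (hv : Integrable v μ)
    (huv : Integrable (fun y => u y ^ 2 / v y) μ) (hpos : ∀ y, 0 < v y)
    (hint : 0 < ∫ y, v y ∂μ) :
    (∫ y, u y ∂μ) ^ 2 / ∫ y, v y ∂μ ≤ ∫ y, u y ^ 2 / v y ∂μ := by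
  set A := ∫ y, u y ∂μ with hA
  set B := ∫ y, v y ∂μ with hB
  have key : ∫ y, (2 * (A / B) * u y - (A / B) ^ 2 * v y) ∂μ ≤ ∫ y, u y ^ 2 / v y ∂μ := by
    refine integral_mono ((hu.const_mul _).sub (hv.const_mul _)) huv fun y => ?_
    simp only
    rw [le_div_iff₀ (hpos y)]
    nlinarith [sq_nonneg (u y - A / B * v y)]
  rw [integral_sub (hu.const_mul _) (hv.const_mul _), integral_const_mul, integral_const_mul,
    ← hA, ← hB] at key
  refine le_trans (le_of_eq ?_) key
  field_simp
  ring

theorem abs_mul_log_le {m C t : ℝ} (hm : 0 < m) (hmt : m ≤ t) (htC : t ≤ C) :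
    |t * Real.log t| ≤ C * (|Real.log m| + |Real.log C|) := by
  have ht : 0 < t := hm.trans_le hmt
  have h1 := Real.log_le_log hm hmt
  have h2 := Real.log_le_log ht htC
  rw [abs_mul, abs_of_pos ht]
  refine mul_le_mul htC ?_ (abs_nonneg _) (ht.le.trans htC)
  rw [abs_le]
  constructor
  · linarith [neg_abs_le (Real.log m), abs_nonneg (Real.log C)]
  · linarith [le_abs_self (Real.log C), abs_nonneg (Real.log m)]

theorem integrable_of_measurable_of_abs_le {α : Type*} [MeasurableSpace α] {μ : Measure α}
    [IsFiniteMeasure μ] {h : α → ℝ} (hm : Measurable h) {C : ℝ} (hC : ∀ x, |h x| ≤ C) :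
    Integrable h μ :=
  Integrable.of_bound hm.aestronglyMeasurable C (.of_forall hC)

theorem integral_bind_kernel {α β : Type*} [MeasurableSpace α] [MeasurableSpace β]
    {μ : Measure α} (K : ProbabilityTheory.Kernel α β) {h : β → ℝ}
    (hh : Integrable h (μ.bind K)) : ∫ y, h y ∂(μ.bind K) = ∫ x, ∫ y, h y ∂(K x) ∂μ := by
  rw [Measure.comp_eq_comp_const_apply] at hh ⊢
  simpa using ProbabilityTheory.Kernel.integral_comp hh

theorem integrable_integral_kernel {α β : Type*} [MeasurableSpace α] [MeasurableSpace β]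
    {μ : Measure α} (K : ProbabilityTheory.Kernel α β) {h : β → ℝ}
    (hh : Integrable h (μ.bind K)) : Integrable (fun x => ∫ y, h y ∂(K x)) μ := by
  rw [Measure.comp_eq_comp_const_apply] at hh
  simpa using hh.integral_comp

theorem ContDiff.continuous_gradient_real {E : Type*} [NormedAddCommGroup E]
    [InnerProductSpace ℝ E] [CompleteSpace E] {f : E → ℝ} (hf : ContDiff ℝ 1 f) :
    Continuous (gradient f) :=
  (InnerProductSpace.toDual ℝ E).symm.continuous.comp (hf.continuous_fderiv one_ne_zero)

theorem stmt_4 {d : ℕ}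
    (κ : EuclideanSpace ℝ (Fin d) → Measure (EuclideanSpace ℝ (Fin d)))
    (hκmeas : Measurable κ) (hκprob : ∀ x, IsProbabilityMeasure (κ x))
    (γ : Measure (EuclideanSpace ℝ (Fin d))) (hγ : IsProbabilityMeasure γ)
    (c κ₀ L₀ : ℝ) (hc : 0 ≤ c) (hκ₀ : 0 ≤ κ₀) (hL₀ : 0 ≤ L₀)
    (hLSIκ : ∀ f : EuclideanSpace ℝ (Fin d) → ℝ, memF f → ∀ x,
      (∫ y, f y * Real.log (f y) ∂(κ x)) -
          (∫ y, f y ∂(κ x)) * Real.log (∫ y, f y ∂(κ x)) ≤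
        2 * c * ∫ y, gradSq f y ∂(κ x))
    (hgrad : ∀ f : EuclideanSpace ℝ (Fin d) → ℝ, memF f →
      Differentiable ℝ (fun x => ∫ y, f y ∂(κ x)) ∧
      ∀ x, ‖gradient (fun x => ∫ y, f y ∂(κ x)) x‖ ≤ κ₀ * ∫ y, ‖gradient f y‖ ∂(κ x))
    (hLSIγ : ∀ g : EuclideanSpace ℝ (Fin d) → ℝ, (∃ C, ∀ x, |g x| ≤ C) →
      Differentiable ℝ g → (∃ C, ∀ x, ‖gradient g x‖ ≤ C) → (∃ c' > 0, ∀ x, c' ≤ g x) →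
      ∫ x, g x * Real.log (g x) ∂γ ≤
        (∫ x, g x ∂γ) * Real.log (∫ x, g x ∂γ) + 2 * L₀ * ∫ x, gradSq g x ∂γ)
    (f : EuclideanSpace ℝ (Fin d) → ℝ) (hf : memF f) :
    ∫ x, f x * Real.log (f x) ∂(γ.bind κ) -
        (∫ x, f x ∂(γ.bind κ)) * Real.log (∫ x, f x ∂(γ.bind κ)) ≤
      2 * (L₀ * κ₀ ^ 2 + c) * ∫ x, gradSq f x ∂(γ.bind κ) := by
  obtain ⟨hsm, ⟨C, hC⟩, ⟨G, hG⟩, m, hm, hmf⟩ := id hf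
  have hC' : ∀ x, f x ≤ C := fun x => (le_abs_self _).trans (hC x)
  have hfpos : ∀ x, 0 < f x := fun x => hm.trans_le (hmf x)
  have hfm : Measurable f := hsm.continuous.measurable
  have hgm : Measurable fun x => ‖gradient f x‖ :=
    (hsm.of_le (by exact_mod_cast le_top)).continuous_gradient_real.norm.measurable
  have hGm : Measurable (gradSq f) := (hgm.pow_const 2).div (hfm.const_mul 4)
  have hlm : Measurable fun x => f x * Real.log (f x) :=
    hfm.mul (Real.measurable_log.comp hfm)
  have hlb : ∀ x, |f x * Real.log (f x)| ≤ C * (|Real.log m| + |Real.log C|) :=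
    fun x => abs_mul_log_le hm (hmf x) (hC' x)
  have hG0 : ∀ x, 0 ≤ gradSq f x := fun x =>
    div_nonneg (sq_nonneg _) (mul_nonneg (by norm_num) (hfpos x).le)
  have hGb : ∀ x, |gradSq f x| ≤ G ^ 2 / (4 * m) := fun x => by
    rw [abs_of_nonneg (hG0 x)]
    exact div_le_div₀ (sq_nonneg _) (pow_le_pow_left₀ (norm_nonneg _) (hG x) 2)
      (by positivity) (by linarith [hmf x])
  let K : ProbabilityTheory.Kernel (EuclideanSpace ℝ (Fin d)) (EuclideanSpace ℝ (Fin d)) :=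
    ⟨κ, hκmeas⟩
  have : ProbabilityTheory.IsMarkovKernel K := ⟨hκprob⟩
  have : IsProbabilityMeasure (γ.bind κ) :=
    inferInstanceAs (IsProbabilityMeasure (γ.bind K))
  have hbind : ∀ h : EuclideanSpace ℝ (Fin d) → ℝ, Measurable h → (∃ D, ∀ x, |h x| ≤ D) →
      ∫ x, h x ∂(γ.bind κ) = ∫ x, ∫ y, h y ∂(κ x) ∂γ := fun h hh ⟨D, hD⟩ =>
    integral_bind_kernel K (integrable_of_measurable_of_abs_le (μ := γ.bind κ) hh hD)
  have hκint : ∀ h : EuclideanSpace ℝ (Fin d) → ℝ, Measurable h → (∃ D, ∀ x, |h x| ≤ D) →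
      Integrable (fun x => ∫ y, h y ∂(κ x)) γ := fun h hh ⟨D, hD⟩ =>
    integrable_integral_kernel K (integrable_of_measurable_of_abs_le (μ := γ.bind κ) hh hD)
  have hfi : ∀ x, Integrable f (κ x) := fun x => integrable_of_measurable_of_abs_le hfm hC
  have hgi : ∀ x, Integrable (fun y => ‖gradient f y‖) (κ x) := fun x =>
    integrable_of_measurable_of_abs_le hgm (C := G) fun y => by simpa using hG y
  have hGi : ∀ x, Integrable (gradSq f) (κ x) := fun x =>
    integrable_of_measurable_of_abs_le hGm hGb
  obtain ⟨hdiff, hgradle⟩ := hgrad f hf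
  have hLκ := hLSIκ f hf
  have hLγ := hLSIγ (fun x => ∫ y, f y ∂(κ x))
  rw [hbind _ hlm ⟨_, hlb⟩, hbind _ hfm ⟨_, hC⟩, hbind _ hGm ⟨_, hGb⟩]
  have hgle : ∀ x, ∫ y, f y ∂(κ x) ≤ C := fun x => by
    simpa using integral_mono (hfi x) (integrable_const C) hC'
  have hleg : ∀ x, m ≤ ∫ y, f y ∂(κ x) := fun x => by
    simpa using integral_mono (integrable_const m) (hfi x) hmf
  have hnle : ∀ x, ∫ y, ‖gradient f y‖ ∂(κ x) ≤ G := fun x => by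
    simpa using integral_mono (hgi x) (integrable_const G) hG
  have hκl := hκint _ hlm ⟨_, hlb⟩
  have hκG := hκint _ hGm ⟨_, hGb⟩
  set g : EuclideanSpace ℝ (Fin d) → ℝ := fun x => ∫ y, f y ∂(κ x) with hg
  have hgpos : ∀ x, 0 < g x := fun x => hm.trans_le (hleg x)
  have hgmeas : Measurable g := hdiff.continuous.measurable
  have hglint : Integrable (fun x => g x * Real.log (g x)) γ :=
    integrable_of_measurable_of_abs_le (hgmeas.mul (Real.measurable_log.comp hgmeas))
      fun x => abs_mul_log_le hm (hleg x) (hgle x)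
  have hent : ∫ x, ∫ y, f y * Real.log (f y) ∂(κ x) ∂γ ≤
      (∫ x, g x * Real.log (g x) ∂γ) + 2 * c * ∫ x, ∫ y, gradSq f y ∂(κ x) ∂γ := by
    rw [← integral_const_mul, ← integral_add hglint (hκG.const_mul _)]
    refine integral_mono hκl (hglint.add (hκG.const_mul _)) fun x => ?_
    have := hLκ x
    simp only [hg]
    linarith
  have hgradSq : ∀ x, gradSq g x ≤ κ₀ ^ 2 * ∫ y, gradSq f y ∂(κ x) := fun x => by
    have hquot : ∀ y, ‖gradient f y‖ ^ 2 / f y = 4 * gradSq f y := fun y => by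
      have := (hfpos y).ne'
      simp only [gradSq]
      field_simp
    have hcs := sq_integral_div_integral_le (hgi x) (hfi x)
      (by simpa only [hquot] using (hGi x).const_mul 4) hfpos (hgpos x)
    simp only [hquot, integral_const_mul] at hcs
    rw [div_le_iff₀ (hgpos x)] at hcs
    have hsq := pow_le_pow_left₀ (norm_nonneg _) (hgradle x) 2
    rw [mul_pow] at hsq
    rw [gradSq, div_le_iff₀ (mul_pos (by norm_num) (hgpos x))]
    nlinarith [mul_le_mul_of_nonneg_left hcs (sq_nonneg κ₀)]
  have hgradint : ∫ x, gradSq g x ∂γ ≤ κ₀ ^ 2 * ∫ x, ∫ y, gradSq f y ∂(κ x) ∂γ := by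
    rw [← integral_const_mul]
    exact integral_mono_of_nonneg
      (.of_forall fun x => div_nonneg (sq_nonneg _) (mul_nonneg (by norm_num) (hgpos x).le))
      (hκG.const_mul _) (.of_forall hgradSq)
  have hlsi := hLγ ⟨C, fun x => by rw [abs_of_pos (hgpos x)]; exact hgle x⟩ hdiff
    ⟨κ₀ * G, fun x => (hgradle x).trans (mul_le_mul_of_nonneg_left (hnle x) hκ₀)⟩ ⟨m, hm, hleg⟩
  linarith [mul_le_mul_of_nonneg_left hgradint hL₀]
end

section
/- Let P be a Markov kernel on ℝ^d with invariant probability measure μ̄, i.e. μ̄P = μ̄. Let p > 1 and c₁, c₂ ≥ 0 be such that the Harnack inequality (Pf(x))^p ≤ (P f^p)(y) · exp(c₁ + c₂ |x − y|²) holds for every bounded measurable f : ℝ^d → [0, ∞) and all x, y ∈ ℝ^d. Let R > 0 be such that μ̄(B_R) > 0 and suppose M̄ := ∫ exp(4 c₂ |x|²) μ̄(dx) < ∞. Then for every bounded measurable f : ℝ^d → [0, ∞) with ∫ f^p dμ̄ ≤ 1, one has ∫ (Pf)^{2p} dμ̄ ≤ (exp(c₁ + 2 c₂ R²) / μ̄(B_R))²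 · M̄. -/
open MeasureTheory

/-- A kernel preserving a finite measure preserves integrals of integrable functions. -/
lemma integrable_and_integral_eq_of_bind_eq_self {α : Type*} [MeasurableSpace α]
    (κ : ProbabilityTheory.Kernel α α) [ProbabilityTheory.IsMarkovKernel κ]
    (μ : Measure α) [IsFiniteMeasure μ] (hinv : μ.bind κ = μ) {g : α → ℝ} (hg : Integrable g μ) :
    Integrable (fun x => ∫ z, g z ∂(κ x)) μ ∧ ∫ x, ∫ z, g z ∂(κ x) ∂μ = ∫ x, g x ∂μ := by
  have key : (κ.comp (ProbabilityTheory.Kernel.const Unit μ)) () = μ := by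
    rw [ProbabilityTheory.Kernel.comp_apply, ProbabilityTheory.Kernel.const_apply, hinv]
  have hg' : Integrable g ((κ.comp (ProbabilityTheory.Kernel.const Unit μ)) ()) := by rwa [key]
  refine ⟨by simpa using hg'.integral_comp, ?_⟩
  have h := ProbabilityTheory.Kernel.integral_comp hg'
  rw [key] at h
  simpa using h.symm

theorem stmt_5 {d : ℕ}
    (P : EuclideanSpace ℝ (Fin d) → Measure (EuclideanSpace ℝ (Fin d)))
    (hPmeas : Measurable P) (hPprob : ∀ x, IsProbabilityMeasure (P x))
    (μ : Measure (EuclideanSpace ℝ (Fin d))) (hμ : IsProbabilityMeasure μ)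
    (hinv : μ.bind P = μ)
    (p c₁ c₂ : ℝ) (hp : 1 < p) (hc₁ : 0 ≤ c₁) (hc₂ : 0 ≤ c₂)
    (hHarnack : ∀ f : EuclideanSpace ℝ (Fin d) → ℝ, Measurable f → (∀ x, 0 ≤ f x) →
      (∃ C, ∀ x, f x ≤ C) → ∀ x y,
      (∫ z, f z ∂(P x)) ^ p ≤
        (∫ z, f z ^ p ∂(P y)) * Real.exp (c₁ + c₂ * ‖x - y‖ ^ 2))
    (R : ℝ) (hR : 0 < R) (hμR : 0 < μ (Metric.closedBall 0 R))
    (hM : Integrable (fun x => Real.exp (4 * c₂ * ‖x‖ ^ 2)) μ)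
    (f : EuclideanSpace ℝ (Fin d) → ℝ) (hfm : Measurable f) (hfnn : ∀ x, 0 ≤ f x)
    (hfb : ∃ C, ∀ x, f x ≤ C) (hfp : ∫ x, f x ^ p ∂μ ≤ 1) :
    ∫ x, (∫ z, f z ∂(P x)) ^ (2 * p) ∂μ ≤
      (Real.exp (c₁ + 2 * c₂ * R ^ 2) / (μ (Metric.closedBall 0 R)).toReal) ^ 2 *
        ∫ x, Real.exp (4 * c₂ * ‖x‖ ^ 2) ∂μ := by
  obtain ⟨C, hC⟩ := hfb
  have hint : Integrable (fun x => f x ^ p) μ :=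
    Integrable.of_bound (C := C ^ p) (hfm.pow_const p).aestronglyMeasurable
      (ae_of_all _ fun x => by
        rw [Real.norm_of_nonneg (Real.rpow_nonneg (hfnn x) p)]
        exact Real.rpow_le_rpow (hfnn x) (hC x) (by linarith))
  let κ : ProbabilityTheory.Kernel (EuclideanSpace ℝ (Fin d)) (EuclideanSpace ℝ (Fin d)) :=
    ⟨P, hPmeas⟩
  have : ProbabilityTheory.IsMarkovKernel κ := ⟨hPprob⟩
  obtain ⟨hgint, hgeq⟩ := integrable_and_integral_eq_of_bind_eq_self κ μ hinv hint
  change Integrable (fun x => ∫ z, f z ^ p ∂(P x)) μ at hgint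
  change ∫ x, ∫ z, f z ^ p ∂(P x) ∂μ = _ at hgeq
  have hgnn : ∀ y, 0 ≤ ∫ z, f z ^ p ∂(P y) := fun y =>
    integral_nonneg fun z => Real.rpow_nonneg (hfnn z) p
  have hPf : ∀ x, 0 ≤ ∫ z, f z ∂(P x) := fun x => integral_nonneg hfnn
  set B := Metric.closedBall (0 : EuclideanSpace ℝ (Fin d)) R
  have hm : 0 < μ.real B := ENNReal.toReal_pos hμR.ne' (measure_ne_top _ _)
  have hpoint : ∀ x, (∫ z, f z ∂(P x)) ^ p ≤
      Real.exp (c₁ + 2 * c₂ * R ^ 2) / μ.real B * Real.exp (2 * c₂ * ‖x‖ ^ 2) := by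
    intro x
    set E := Real.exp (c₁ + 2 * c₂ * R ^ 2) * Real.exp (2 * c₂ * ‖x‖ ^ 2)
    have hEpos : 0 < E := by positivity
    have hlow : ∀ y ∈ B, (∫ z, f z ∂(P x)) ^ p ≤ (∫ z, f z ^ p ∂(P y)) * E := by
      intro y hy
      refine (hHarnack f hfm hfnn ⟨C, hC⟩ x y).trans
        (mul_le_mul_of_nonneg_left ?_ (hgnn y))
      rw [show E = _ from (Real.exp_add _ _).symm]
      apply Real.exp_le_exp.mpr
      have hyR : ‖y‖ ≤ R := mem_closedBall_zero_iff.mp hy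
      have h1 : ‖x - y‖ ^ 2 ≤ 2 * ‖x‖ ^ 2 + 2 * R ^ 2 := by
        have h2 : ‖x - y‖ ≤ ‖x‖ + R := (norm_sub_le x y).trans (by linarith)
        nlinarith [norm_nonneg (x - y), sq_nonneg (‖x‖ - R)]
      nlinarith [mul_le_mul_of_nonneg_left h1 hc₂]
    have hset := setIntegral_ge_of_const_le_real Metric.isClosed_closedBall.measurableSet
      (measure_ne_top μ B) hlow (hgint.mul_const E).integrableOn
    have htot : ∫ y in B, (∫ z, f z ^ p ∂(P y)) * E ∂μ ≤ E := by
      calc ∫ y in B, (∫ z, f z ^ p ∂(P y)) * E ∂μ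
          ≤ ∫ y, (∫ z, f z ^ p ∂(P y)) * E ∂μ :=
            setIntegral_le_integral (hgint.mul_const E)
              (ae_of_all _ fun y => mul_nonneg (hgnn y) hEpos.le)
        _ = (∫ x, f x ^ p ∂μ) * E := by rw [integral_mul_const, hgeq]
        _ ≤ E := mul_le_of_le_one_left hEpos.le hfp
    rw [div_mul_eq_mul_div, le_div_iff₀ hm]
    exact hset.trans htot
  rw [← integral_const_mul]
  refine integral_mono_of_nonneg (ae_of_all _ fun x => Real.rpow_nonneg (hPf x) _)
    (hM.const_mul _) (ae_of_all _ fun x => ?_)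
  have hexp : Real.exp (4 * c₂ * ‖x‖ ^ 2) = Real.exp (2 * c₂ * ‖x‖ ^ 2) ^ 2 := by
    rw [← Real.exp_nat_mul]
    congr 1
    push_cast
    ring
  change (∫ z, f z ∂(P x)) ^ (2 * p) ≤
    (Real.exp (c₁ + 2 * c₂ * R ^ 2) / μ.real B) ^ 2 * Real.exp (4 * c₂ * ‖x‖ ^ 2)
  rw [hexp, ← mul_pow, mul_comm 2 p, Real.rpow_mul (hPf x), Real.rpow_two]
  exact pow_le_pow_left₀ (Real.rpow_nonneg (hPf x) p) (hpoint x) 2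
end
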